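/- Let X be a Peano continuum having a free arc, which is neither an arc nor a circle, having no maximal free open interval of Type I, and let F be a commutative subsemigroup of C^0(X) consisting of continuous open maps that is sensitive with sensitivity constant c > 0. Set ε = c/7, let δ = δ(ε) ∈ (0, ε/2] be such that any two points of X at positive distance at most δ are joined by an arc of diameter less than ε, and let U_1, …, U_n be arcwise connected open subsets of X with ∪_{i=1}^n U_i = X and diam(U_i) < ε for each i. For f_1, …, f_m ∈ F define S(f_1,…,f_m) = Σ_{i=1}^n d(U_i, ∪_{j=1}^m f_j(U_i)). If f_1, …, f_m ∈ F and there is a free arc A_m ⊆ X which is a jumping arc of {f_1,…,f_m} such that A_m, f_1(A_m), …, f_m(A_m) are contained in a single maximal free open interval, then there exist a free arc A_{m+1} ⊆ X and f_{m+1} ∈ F such that A_{m+1} is a jumping arc of {f_1,…,f_{m+1}}, the sets A_{m+1}, f_1(A_{m+1}), …, f_{m+1}(A_{m+1}) are contained in a single maximal free open interval, and S(f_1,…,f_m,f_{m+1}) < S(f_1,…,f_m) − δ. -/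

import Mathlib

open Set Metric Topology

/-- The whole space `X` is an arc, i.e. homeomorphic to `[0,1]`. -/
def SpaceIsArc (X : Type*) [TopologicalSpace X] : Prop :=
  Nonempty (X ≃ₜ Set.Icc (0:ℝ) 1)

/-- The whole space `X` is a circle, i.e. homeomorphic to the unit circle in `ℂ`. -/
def SpaceIsCircle (X : Type*) [TopologicalSpace X] : Prop :=
  Nonempty (X ≃ₜ Metric.sphere (0:ℂ) 1)

/-- A subset `A` is an arc: with the subspace topology it is homeomorphic to `[0,1]`. -/
def IsArc {X : Type*} [TopologicalSpace X] (A : Set X) : Prop :=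
  Nonempty (A ≃ₜ Set.Icc (0:ℝ) 1)

/-- A subset `A` is a circle: with the subspace topology it is homeomorphic to `S¹`. -/
def IsCircleSet {X : Type*} [TopologicalSpace X] (A : Set X) : Prop :=
  Nonempty (A ≃ₜ Metric.sphere (0:ℂ) 1)

/-- `A` is an arc with endpoints `a` and `b`: it is the image of a continuous
injective parametrization of `[0,1]` with `γ 0 = a` and `γ 1 = b`. -/
def IsArcEnds {X : Type*} [TopologicalSpace X] (A : Set X) (a b : X) : Prop :=
  ∃ γ : ℝ → X, ContinuousOn γ (Set.Icc 0 1) ∧ Set.InjOn γ (Set.Icc 0 1) ∧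
    γ '' Set.Icc 0 1 = A ∧ γ 0 = a ∧ γ 1 = b

/-- A free open interval: an open subset homeomorphic to `(0,1)`. -/
def IsFreeOpenInterval {X : Type*} [TopologicalSpace X] (J : Set X) : Prop :=
  IsOpen J ∧ Nonempty (J ≃ₜ Set.Ioo (0:ℝ) 1)

/-- A free arc: the closure of a free open interval, homeomorphic to `[0,1]`. -/
def IsFreeArc {X : Type*} [TopologicalSpace X] (A : Set X) : Prop :=
  ∃ J : Set X, IsFreeOpenInterval J ∧ A = closure J ∧ IsArc A

/-- A maximal free open interval: no free open interval properly contains it. -/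
def IsMaxFreeOpenInterval {X : Type*} [TopologicalSpace X] (J : Set X) : Prop :=
  IsFreeOpenInterval J ∧ ∀ K : Set X, IsFreeOpenInterval K → J ⊆ K → J = K

/-- `x` is an endpoint of the space `X`: every open set containing `x` contains an
open neighborhood of `x` whose boundary is a single point. -/
def IsEndpointOf (X : Type*) [TopologicalSpace X] (x : X) : Prop :=
  ∀ U : Set X, IsOpen U → x ∈ U → ∃ V : Set X, IsOpen V ∧ x ∈ V ∧ V ⊆ U ∧
    ∃ y : X, frontier V = {y}

/-- A maximal free open interval of Type I: its closure is an arc `J ∪ {a,b}` with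
`a, b ∉ J` and at least one of `a, b` an endpoint of `X`. -/
def IsTypeI {X : Type*} [TopologicalSpace X] (J : Set X) : Prop :=
  IsMaxFreeOpenInterval J ∧ ∃ a b : X, a ≠ b ∧ a ∉ J ∧ b ∉ J ∧
    closure J = J ∪ {a, b} ∧ IsArcEnds (closure J) a b ∧
    (IsEndpointOf X a ∨ IsEndpointOf X b)

/-- The model simple triod in the complex plane: three unit segments from the
origin in directions `π/3`, `π`, `5π/3`. -/
noncomputable def triodModel : Set ℂ :=
  ⋃ θ ∈ ({Real.pi / 3, Real.pi, 5 * Real.pi / 3} : Set ℝ),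
    (fun r : ℝ => (r : ℂ) * Complex.exp (θ * Complex.I)) '' Set.Icc (0:ℝ) 1

/-- `A` is a simple triod. -/
def IsSimpleTriod {X : Type*} [TopologicalSpace X] (A : Set X) : Prop :=
  Nonempty (A ≃ₜ triodModel)

/-- `U` contains no simple triod. -/
def ContainsNoTriod {X : Type*} [TopologicalSpace X] (U : Set X) : Prop :=
  ∀ A : Set X, A ⊆ U → ¬ IsSimpleTriod A

/-- The distance between two subsets of a metric space:
`d(S,T) = inf { dist s t | s ∈ S, t ∈ T }`. -/
noncomputable def setDist {X : Type*} [MetricSpace X] (S T : Set X) : ℝ :=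
  sInf (Set.image2 dist S T)

set_option linter.unusedSectionVars false

/-- A function collapsing the complement of a half-open arc starting at `e`: it parametrizes
the open set `{φ < 1}` by `[0,1)` and is constantly `1` elsewhere. -/
structure IsHalfArcFun {X : Type*} [TopologicalSpace X] (e : X) (φ : X → ℝ) : Prop where
  continuous : Continuous φ
  nonneg : ∀ x, 0 ≤ φ x
  le_one : ∀ x, φ x ≤ 1
  map_base : φ e = 0
  exists_eq_one : ∃ x, φ x = 1
  inj : ∀ x y, φ x < 1 → φ x = φ y → x = y

namespace IsHalfArcFun

variable {X : Type*} [MetricSpace X] [CompactSpace X] [ConnectedSpace X] {e : X} {φ ψ : X → ℝ}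

theorem exists_eq (h : IsHalfArcFun e φ) {r : ℝ} (h0 : 0 ≤ r) (h1 : r ≤ 1) : ∃ x, φ x = r := by
  obtain ⟨x, hx⟩ := h.exists_eq_one
  exact mem_range_of_exists_le_of_exists_ge h.continuous ⟨e, h.map_base.trans_le h0⟩
    ⟨x, h1.trans_eq hx.symm⟩

theorem nonempty_homeomorph (h : IsHalfArcFun e φ) {S : Set ℝ} (hS : S ⊆ Ico 0 1) :
    Nonempty ((φ ⁻¹' S) ≃ₜ S) := by
  have hb : Function.Bijective (S.restrictPreimage φ) := by
    constructor
    · rintro ⟨x, hx⟩ ⟨y, hy⟩ hxy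
      exact Subtype.ext (h.inj x y (hS hx).2 (congrArg Subtype.val hxy))
    · rintro ⟨r, hr⟩
      obtain ⟨x, hx⟩ := h.exists_eq (hS hr).1 (hS hr).2.le
      exact ⟨⟨x, by simpa [hx] using hr⟩, Subtype.ext hx⟩
  exact ⟨(Equiv.ofBijective _ hb).toHomeomorphOfContinuousClosed
    h.continuous.restrictPreimage (h.continuous.isClosedMap.restrictPreimage S)⟩

theorem isPreconnected_preimage (h : IsHalfArcFun e φ) {S : Set ℝ} (hS : S ⊆ Ico 0 1)
    (hc : IsPreconnected S) : IsPreconnected (φ ⁻¹' S) := by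
  obtain ⟨H⟩ := h.nonempty_homeomorph hS
  have := isPreconnected_iff_preconnectedSpace.1 hc
  exact isPreconnected_iff_preconnectedSpace.2
    (H.symm.surjective.denseRange.preconnectedSpace H.symm.continuous)

theorem preimage_Ico_eq (h : IsHalfArcFun e φ) : φ ⁻¹' Ico 0 1 = {x | φ x < 1} := by
  ext x; simp [h.nonneg x]

theorem isPreconnected_lt_one (h : IsHalfArcFun e φ) : IsPreconnected {x | φ x < 1} :=
  h.preimage_Ico_eq ▸ h.isPreconnected_preimage subset_rfl isPreconnected_Ico

theorem subset_or_subset (h : IsHalfArcFun e φ) (h' : IsHalfArcFun e ψ) :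
    {x | φ x < 1} ⊆ {x | ψ x < 1} ∨ {x | ψ x < 1} ⊆ {x | φ x < 1} := by
  by_contra! hcon
  obtain ⟨x, hx, hx'⟩ := not_subset.1 hcon.1
  refine hcon.2 ?_
  have hcl : IsClosed {x | 1 ≤ ψ x} := isClosed_le continuous_const h'.continuous
  obtain ⟨z, hz, hmin⟩ := hcl.isCompact.exists_isMinOn ⟨x, not_lt.1 (show ¬ ψ x < 1 from hx')⟩
    h.continuous.continuousOn
  have hzx : φ z ≤ φ x := hmin (not_lt.1 (show ¬ ψ x < 1 from hx') : 1 ≤ ψ x)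
  have hz1 : φ z < 1 := hzx.trans_lt hx
  have hpos : 0 < φ z := by
    refine (h.nonneg z).lt_of_ne fun h0 => ?_
    have : z = e := h.inj _ _ hz1 (by rw [h.map_base, h0])
    have hz' : 1 ≤ ψ z := hz
    rw [this, h'.map_base] at hz'
    norm_num at hz'
  have hsub : {y | ψ y < 1} ⊆ {y | φ y < φ z} := by
    refine h'.isPreconnected_lt_one.subset_of_closure_inter_subset
      (isOpen_lt h.continuous continuous_const)
      ⟨e, by simp [h'.map_base], by simpa [h.map_base] using hpos⟩ ?_
    rintro y ⟨hy, hy'⟩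
    have hle : φ y ≤ φ z := closure_lt_subset_le h.continuous continuous_const hy
    refine lt_of_le_of_ne hle fun heq => ?_
    have := h.inj y z (heq ▸ hz1) heq
    subst this
    exact absurd (show ψ y < 1 from hy') (not_lt.2 hz)
  exact fun y hy => (hsub hy).trans hz1

theorem scale (h : IsHalfArcFun e φ) {r : ℝ} (h0 : 0 < r) (h1 : r ≤ 1) :
    IsHalfArcFun e (fun x => min (φ x / r) 1) where
  continuous := (h.continuous.div_const r).min continuous_const
  nonneg x := le_min (div_nonneg (h.nonneg x) h0.le) zero_le_one
  le_one x := min_le_right _ _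
  map_base := by simp [h.map_base]
  exists_eq_one := by
    obtain ⟨x, hx⟩ := h.exists_eq_one
    exact ⟨x, min_eq_right (by rw [hx]; exact (one_le_div h0).2 h1)⟩
  inj x y hx hxy := by
    have hx' : φ x / r < 1 := by
      by_contra! hc
      simp [min_eq_right hc] at hx
    rw [min_eq_left hx'.le] at hxy
    have hy' : φ y / r < 1 := by
      by_contra! hc
      rw [min_eq_right hc] at hxy
      exact hx'.ne hxy
    rw [min_eq_left hy'.le] at hxy
    rw [div_lt_one h0] at hx'
    exact h.inj x y (hx'.trans_le h1) ((div_left_inj' h0.ne').1 hxy)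

theorem scale_lt_one_iff {r : ℝ} (h0 : 0 < r) (x : X) : min (φ x / r) 1 < 1 ↔ φ x < r := by
  simp [div_lt_one h0]

theorem monotone_of_lt (h : IsHalfArcFun e φ) (h' : IsHalfArcFun e ψ) {x y : X}
    (hxy : φ x < φ y) : ψ x ≤ ψ y := by
  by_contra! hlt
  have hy : 0 < φ y := (h.nonneg x).trans_lt hxy
  have hx : 0 < ψ x := (h'.nonneg y).trans_lt hlt
  rcases (h.scale hy (h.le_one y)).subset_or_subset (h'.scale hx (h'.le_one x)) with hs | hs
  · have := hs (show x ∈ _ from (scale_lt_one_iff hy x).2 hxy)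
    exact lt_irrefl _ ((scale_lt_one_iff hx x).1 this)
  · have := hs (show y ∈ _ from (scale_lt_one_iff hx y).2 hlt)
    exact lt_irrefl _ ((scale_lt_one_iff hy y).1 this)

/-- Among the half-open arcs starting at `e` there is a largest one. -/
theorem exists_maximal (h : IsHalfArcFun e φ) :
    ∃ Φ : X → ℝ, IsHalfArcFun e Φ ∧ ∀ ψ, IsHalfArcFun e ψ → {x | ψ x < 1} ⊆ {x | Φ x < 1} := by
  obtain ⟨T, hTc, hTS, hTU⟩ := TopologicalSpace.isOpen_sUnion_countable
    {V : Set X | ∃ ψ, IsHalfArcFun e ψ ∧ V = {x | ψ x < 1}}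
    (by rintro _ ⟨ψ, hψ, rfl⟩; exact isOpen_lt hψ.continuous continuous_const)
  have hTne : T.Nonempty := by
    have : e ∈ ⋃₀ T := hTU ▸ ⟨_, ⟨φ, h, rfl⟩, by simp [h.map_base]⟩
    obtain ⟨V, hV, -⟩ := this
    exact ⟨V, hV⟩
  obtain ⟨V, rfl⟩ := hTc.exists_eq_range hTne
  choose ψ hψ hψV using fun k => hTS (mem_range_self k)
  have hsum : Summable fun k : ℕ => (1 / 2 : ℝ) ^ k / 2 := by
    simpa using (summable_geometric_two).div_const 2
  have hone : ∑' k : ℕ, (1 / 2 : ℝ) ^ k / 2 = 1 := by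
    rw [tsum_div_const, tsum_geometric_two]; norm_num
  have hle : ∀ k x, (1 / 2 : ℝ) ^ k / 2 * ψ k x ≤ (1 / 2 : ℝ) ^ k / 2 := fun k x =>
    mul_le_of_le_one_right (by positivity) ((hψ k).le_one x)
  have hnn : ∀ k x, 0 ≤ (1 / 2 : ℝ) ^ k / 2 * ψ k x := fun k x =>
    mul_nonneg (by positivity) ((hψ k).nonneg x)
  have hs : ∀ x, Summable fun k => (1 / 2 : ℝ) ^ k / 2 * ψ k x := fun x =>
    Summable.of_nonneg_of_le (fun k => hnn k x) (fun k => hle k x) hsum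
  set Φ : X → ℝ := fun x => ∑' k, (1 / 2 : ℝ) ^ k / 2 * ψ k x with hΦ
  have hmono : ∀ k x y, ψ k x < ψ k y → Φ x < Φ y := by
    intro k x y hxy
    refine Summable.tsum_lt_tsum (i := k) (fun l => ?_) ?_ (hs x) (hs y)
    · exact mul_le_mul_of_nonneg_left ((hψ k).monotone_of_lt (hψ l) hxy) (by positivity)
    · exact mul_lt_mul_of_pos_left hxy (by positivity)
  have hcont : Continuous Φ := by
    refine continuous_tsum (fun k => continuous_const.mul (hψ k).continuous) hsum fun k x => ?_
    rw [Real.norm_of_nonneg (hnn k x)]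
    exact hle k x
  have hlt : ∀ x, Φ x < 1 → ∃ k, ψ k x < 1 := by
    intro x hx
    by_contra! hc
    have : ∀ k, ψ k x = 1 := fun k => le_antisymm ((hψ k).le_one x) (hc k)
    simp only [hΦ, this, mul_one, hone] at hx
    exact lt_irrefl _ hx
  have hle1 : ∀ x, Φ x ≤ 1 := fun x => by
    rw [← hone]; exact (hs x).tsum_le_tsum (fun k => hle k x) hsum
  have hlt' : ∀ k x, ψ k x < 1 → Φ x < 1 := by
    intro k x hx
    obtain ⟨y, hy⟩ := (hψ k).exists_eq_one
    exact (hmono k x y (hy ▸ hx)).trans_le (hle1 y)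
  refine ⟨Φ, ⟨hcont, fun x => tsum_nonneg fun k => hnn k x, hle1, ?_, ?_, ?_⟩, ?_⟩
  · simp [hΦ, fun k => (hψ k).map_base]
  · obtain ⟨x, -, hx⟩ := isCompact_univ.exists_isMaxOn ⟨e, mem_univ e⟩ hcont.continuousOn
    refine ⟨x, le_antisymm (hle1 x) ?_⟩
    by_contra! hc
    obtain ⟨k, hk⟩ := hlt x hc
    obtain ⟨y, hy⟩ := (hψ k).exists_eq_one
    exact absurd (hx (mem_univ y)) (not_le.2 (hmono k x y (hy ▸ hk)))
  · intro x y hx hxy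
    obtain ⟨k, hk⟩ := hlt x hx
    refine (hψ k).inj x y hk ?_
    by_contra hne
    rcases lt_or_gt_of_ne hne with hlt | hlt
    · exact (hmono k _ _ hlt).ne hxy
    · exact (hmono k _ _ hlt).ne' hxy
  · intro ψ' hψ' x hx
    have : x ∈ ⋃₀ range V := hTU ▸ ⟨_, ⟨ψ', hψ', rfl⟩, hx⟩
    obtain ⟨_, ⟨k, rfl⟩, hxk⟩ := this
    rw [hψV k] at hxk
    exact hlt' k x hxk

theorem eq_base (h : IsHalfArcFun e φ) {x : X} (hx : φ x = 0) : x = e :=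
  h.inj _ _ (by rw [hx]; exact zero_lt_one) (by rw [hx, h.map_base])

theorem isFreeOpenInterval (h : IsHalfArcFun e φ) : IsFreeOpenInterval (φ ⁻¹' Ioo 0 1) :=
  ⟨isOpen_Ioo.preimage h.continuous, h.nonempty_homeomorph Ioo_subset_Ico_self⟩

theorem Icc_subset_image_closure (h : IsHalfArcFun e φ) :
    Icc 0 1 ⊆ φ '' closure (φ ⁻¹' Ioo 0 1) := by
  have hcl : IsClosed (φ '' closure (φ ⁻¹' Ioo 0 1)) := h.continuous.isClosedMap _ isClosed_closure
  rw [← closure_Ioo (zero_ne_one (α := ℝ))]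
  refine hcl.closure_subset_iff.2 fun r hr => ?_
  obtain ⟨x, rfl⟩ := h.exists_eq hr.1.le hr.2.le
  exact ⟨x, subset_closure hr, rfl⟩

theorem exists_closure_eq [LocallyConnectedSpace X] (h : IsHalfArcFun e φ) :
    ∃ b, φ b = 1 ∧ closure (φ ⁻¹' Ioo 0 1) = {x | φ x < 1} ∪ {b} := by
  have key : ∀ b ∈ closure (φ ⁻¹' Ioo 0 1), φ b = 1 → ∀ O, IsOpen O → IsConnected O → b ∈ O →
      ∃ r < 1, Icc r 1 ⊆ φ '' O := by
    intro b hb hb1 O hO hOc hbO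
    obtain ⟨x, hxO, hx⟩ := mem_closure_iff.1 hb O hO hbO
    refine ⟨φ x, hx.2, ?_⟩
    rw [← hb1]
    exact (hOc.isPreconnected.image φ h.continuous.continuousOn).ordConnected.out
      ⟨x, hxO, rfl⟩ ⟨b, hbO, rfl⟩
  obtain ⟨b, hb, hb1⟩ := h.Icc_subset_image_closure (right_mem_Icc.2 zero_le_one)
  refine ⟨b, hb1, Subset.antisymm (fun x hx => ?_) ?_⟩
  · by_cases hx1 : φ x < 1
    · exact Or.inl hx1
    right
    replace hx1 : φ x = 1 := le_antisymm (h.le_one x) (not_lt.1 hx1)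
    by_contra hne
    obtain ⟨O, O', hO, hO', hxO, hbO', hd⟩ := t2_separation hne
    obtain ⟨Q, ⟨hQ, hxQ, hQc⟩, hQO⟩ :=
      (LocallyConnectedSpace.open_connected_basis x).mem_iff.1 (hO.mem_nhds hxO)
    obtain ⟨Q', ⟨hQ', hbQ', hQc'⟩, hQO'⟩ :=
      (LocallyConnectedSpace.open_connected_basis b).mem_iff.1 (hO'.mem_nhds hbO')
    obtain ⟨r, hr, hrQ⟩ := key x hx hx1 Q hQ hQc hxQ
    obtain ⟨r', hr', hrQ'⟩ := key b hb hb1 Q' hQ' hQc' hbQ'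
    obtain ⟨s, hs, hs1⟩ := exists_between (max_lt hr hr')
    obtain ⟨y, hy, hys⟩ := hrQ ⟨(le_max_left _ _).trans hs.le, hs1.le⟩
    obtain ⟨y', hy', hys'⟩ := hrQ' ⟨(le_max_right _ _).trans hs.le, hs1.le⟩
    have : y = y' := h.inj _ _ (hys ▸ hs1) (hys.trans hys'.symm)
    exact disjoint_left.1 hd (hQO hy) (this ▸ hQO' hy')
  · rintro x (hx | rfl)
    · obtain ⟨z, hz, hzx⟩ := h.Icc_subset_image_closure ⟨h.nonneg x, h.le_one x⟩
      rwa [h.inj x z hx hzx.symm]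
    · exact hb

theorem isArcEnds (h : IsHalfArcFun e φ) {b : X} (hb : φ b = 1)
    (hcl : closure (φ ⁻¹' Ioo 0 1) = {x | φ x < 1} ∪ {b}) :
    IsArcEnds (closure (φ ⁻¹' Ioo 0 1)) e b := by
  set Y := closure (φ ⁻¹' Ioo 0 1) with hY
  have hmaps : ∀ x : Y, φ x ∈ Icc (0 : ℝ) 1 := fun x => ⟨h.nonneg x, h.le_one x⟩
  let f : Y → Icc (0 : ℝ) 1 := fun x => ⟨φ x, hmaps x⟩
  have hf : Continuous f := by
    have := h.continuous
    fun_prop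
  have hYmem : ∀ x ∈ Y, φ x < 1 ∨ x = b := fun x hx => hcl.subset hx
  have hbij : Function.Bijective f := by
    constructor
    · rintro ⟨x, hx⟩ ⟨y, hy⟩ hxy
      have hxy' : φ x = φ y := congrArg Subtype.val hxy
      apply Subtype.ext
      rcases hYmem x hx with h1 | rfl
      · exact h.inj x y h1 hxy'
      rcases hYmem y hy with h1 | rfl
      · exact (h.inj y x h1 hxy'.symm).symm
      · rfl
    · rintro ⟨r, hr⟩
      obtain ⟨x, hx, rfl⟩ := h.Icc_subset_image_closure hr
      exact ⟨⟨x, hx⟩, rfl⟩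
  have : CompactSpace Y := isCompact_iff_compactSpace.1 isClosed_closure.isCompact
  let H : Y ≃ₜ Icc (0 : ℝ) 1 := (Equiv.ofBijective f hbij).toHomeomorphOfContinuousClosed hf
    hf.isClosedMap
  have hH : ∀ (r : Icc (0 : ℝ) 1), φ (H.symm r) = r := fun r => by
    have : H (H.symm r) = r := H.apply_symm_apply r
    exact congrArg Subtype.val this
  refine ⟨fun r => H.symm (projIcc 0 1 zero_le_one r), ?_, ?_, ?_, ?_, ?_⟩
  · exact (continuous_subtype_val.comp
      (H.symm.continuous.comp continuous_projIcc)).continuousOn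
  · intro r hr s hs hrs
    have := congrArg φ hrs
    simp only [hH, projIcc_of_mem zero_le_one hr, projIcc_of_mem zero_le_one hs] at this
    exact this
  · ext x
    constructor
    · rintro ⟨r, -, rfl⟩
      exact (H.symm _).2
    · intro hx
      refine ⟨φ x, hmaps ⟨x, hx⟩, ?_⟩
      simp only [projIcc_of_mem zero_le_one (hmaps ⟨x, hx⟩)]
      have : (⟨φ x, hmaps ⟨x, hx⟩⟩ : Icc (0 : ℝ) 1) = H ⟨x, hx⟩ := rfl
      simp [this]
  · refine h.eq_base ?_
    simp [hH]
  · have h1 : φ (H.symm (projIcc 0 1 zero_le_one 1)) = 1 := by simp [hH]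
    rcases hYmem _ (H.symm (projIcc 0 1 zero_le_one 1)).2 with h2 | h2
    · exact absurd h1 h2.ne
    · exact h2

theorem exists_lt_subset (h : IsHalfArcFun e φ) {O : Set X} (hO : IsOpen O) (he : e ∈ O) :
    ∃ r, 0 < r ∧ r < 1 ∧ {x | φ x < r} ⊆ O := by
  by_cases hne : Oᶜ.Nonempty
  · obtain ⟨z, hz, hmin⟩ := hO.isClosed_compl.isCompact.exists_isMinOn hne
      h.continuous.continuousOn
    have hpos : 0 < φ z := (h.nonneg z).lt_of_ne fun h0 => hz (h.eq_base h0.symm ▸ he)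
    refine ⟨φ z / 2, by linarith, by linarith [h.le_one z], fun x hx => ?_⟩
    by_contra hxO
    have h1 : φ z ≤ φ x := hmin hxO
    have h2 : φ x < φ z / 2 := hx
    linarith
  · refine ⟨1 / 2, by norm_num, by norm_num, fun x _ => ?_⟩
    by_contra hxO
    exact hne ⟨x, hxO⟩

theorem isEndpointOf (h : IsHalfArcFun e φ) : IsEndpointOf X e := by
  intro O hO he
  obtain ⟨r, hr0, hr1, hrO⟩ := h.exists_lt_subset hO he
  have hop : IsOpen {x | φ x < r} := isOpen_lt h.continuous continuous_const
  refine ⟨_, hop, by simpa [h.map_base] using hr0, hrO, ?_⟩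
  obtain ⟨y, hy⟩ := h.exists_eq hr0.le hr1.le
  refine ⟨y, ?_⟩
  have hsub : frontier {x | φ x < r} ⊆ {y} := fun x hx => by
    have hxr : φ x = r := frontier_lt_subset_eq h.continuous continuous_const hx
    exact h.inj _ _ (hxr ▸ hr1) (hxr.trans hy.symm)
  have hne : (frontier {x | φ x < r}).Nonempty := by
    rw [nonempty_iff_ne_empty]
    intro hfr
    rcases isClopen_iff.1 (isClopen_iff_frontier_eq_empty.2 hfr) with h1 | h1
    · have : e ∈ {x | φ x < r} := by simpa [h.map_base] using hr0
      simp [h1] at this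
    · have : y ∈ {x | φ x < r} := h1 ▸ mem_univ y
      exact absurd hy (ne_of_lt this)
  exact hne.subset_singleton_iff.1 hsub

theorem base_notMem (h : IsHalfArcFun e φ) {q : ℝ → X} (hq : IsOpenEmbedding q) :
    e ∉ range q := by
  rintro ⟨τ, rfl⟩
  obtain ⟨r, hr0, hr1, hrO⟩ := h.exists_lt_subset hq.isOpen_range ⟨τ, rfl⟩
  have hpre : (q ⁻¹' (φ ⁻¹' Ioo 0 r)).OrdConnected :=
    (IsPreconnected.preimage_of_isOpenMap (h.isPreconnected_preimage
      (fun x hx => ⟨hx.1.le, hx.2.trans hr1⟩) isPreconnected_Ioo) hq.injective hq.isOpenMap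
      fun x hx => hrO hx.2).ordConnected
  have hnhds : {u | φ (q u) < r} ∈ 𝓝 τ :=
    (isOpen_lt (h.continuous.comp hq.continuous) continuous_const).mem_nhds
      (by simpa [h.map_base] using hr0)
  obtain ⟨η, hη, hball⟩ := Metric.mem_nhds_iff.1 hnhds
  have hmem : ∀ u, |u - τ| < η → u ≠ τ → u ∈ q ⁻¹' (φ ⁻¹' Ioo 0 r) := fun u hu hne =>
    ⟨(h.nonneg _).lt_of_ne fun h0 => hne (hq.injective (h.eq_base h0.symm)),
      hball (by simpa [Real.dist_eq] using hu)⟩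
  have hτ : τ ∈ q ⁻¹' (φ ⁻¹' Ioo 0 r) := hpre.out
    (hmem (τ - η / 2) (by rw [abs_lt]; constructor <;> linarith) (by linarith))
    (hmem (τ + η / 2) (by rw [abs_lt]; constructor <;> linarith) (by linarith))
    ⟨by linarith, by linarith⟩
  exact absurd h.map_base (ne_of_gt hτ.1)

end IsHalfArcFun

theorem IsFreeOpenInterval.exists_isOpenEmbedding {X : Type*} [TopologicalSpace X] {K : Set X}
    (hK : IsFreeOpenInterval K) : ∃ q : ℝ → X, IsOpenEmbedding q ∧ range q = K := by
  obtain ⟨hKo, ⟨H⟩⟩ := hK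
  have hpi := Real.pi_pos
  have hmem : ∀ x : ℝ, (1 / 2 : ℝ) + Real.arctan x / Real.pi ∈ Ioo (0 : ℝ) 1 := fun x => by
    have h1 := Real.neg_pi_div_two_lt_arctan x
    have h2 := Real.arctan_lt_pi_div_two x
    constructor
    · have : -(1 / 2) < Real.arctan x / Real.pi := by rw [lt_div_iff₀ hpi]; linarith
      linarith
    · have : Real.arctan x / Real.pi < 1 / 2 := by rw [div_lt_iff₀ hpi]; linarith
      linarith
  let T : ℝ ≃ₜ Ioo (0 : ℝ) 1 :=
    { toFun := fun x => ⟨_, hmem x⟩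
      invFun := fun y => Real.tan (((y : ℝ) - 1 / 2) * Real.pi)
      left_inv := fun x => by
        have : ((1 / 2 : ℝ) + Real.arctan x / Real.pi - 1 / 2) * Real.pi = Real.arctan x := by
          field_simp; ring
        simp only [this, Real.tan_arctan]
      right_inv := fun y => by
        have h0 := y.2.1
        have h1 := y.2.2
        apply Subtype.ext
        simp only
        rw [Real.arctan_tan (by nlinarith) (by nlinarith)]
        field_simp; ring
      continuous_toFun := by
        have := Real.continuous_arctan
        fun_prop
      continuous_invFun := by
        rw [continuous_iff_continuousAt]
        intro y
        have h0 := y.2.1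
        have h1 := y.2.2
        refine ContinuousAt.comp (f := fun y : Ioo (0 : ℝ) 1 => ((y : ℝ) - 1 / 2) * Real.pi)
          (Real.continuousAt_tan.2 (Real.cos_pos_of_mem_Ioo ⟨by nlinarith, by nlinarith⟩).ne')
          (by fun_prop) }
  refine ⟨fun x => H.symm (T x),
    hKo.isOpenEmbedding_subtypeVal.comp (H.symm.isOpenEmbedding.comp T.isOpenEmbedding), ?_⟩
  have : range (fun x => (H.symm (T x) : X)) = Subtype.val '' range (H.symm ∘ T) := by
    rw [← range_comp]; rfl
  rw [this, (H.symm.surjective.comp T.surjective).range_eq, image_univ, Subtype.range_coe]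

theorem IsOpen.csSup_notMem {S : Set ℝ} (hS : IsOpen S) (hb : BddAbove S) : sSup S ∉ S := by
  intro h
  obtain ⟨u, hu, huS⟩ := (mem_nhdsGT_iff_exists_Ioo_subset).1
    (mem_nhdsWithin_of_mem_nhds (hS.mem_nhds h) : S ∈ 𝓝[>] sSup S)
  have hu' : sSup S < u := hu
  have := le_csSup hb (huS ⟨show sSup S < (sSup S + u) / 2 by linarith, by linarith⟩)
  linarith

theorem IsOpen.csInf_notMem {S : Set ℝ} (hS : IsOpen S) (hb : BddBelow S) : sInf S ∉ S := by
  intro h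
  obtain ⟨u, hu, huS⟩ := (mem_nhdsLT_iff_exists_Ioo_subset).1
    (mem_nhdsWithin_of_mem_nhds (hS.mem_nhds h) : S ∈ 𝓝[<] sInf S)
  have hu' : u < sInf S := hu
  have := csInf_le hb (huS ⟨show u < (sInf S + u) / 2 by linarith, by linarith⟩)
  linarith

namespace IsHalfArcFun

variable {X : Type*} [MetricSpace X] [CompactSpace X] [ConnectedSpace X] {e : X} {φ ψ : X → ℝ}

open Classical in
/-- A half-open arc that ends inside a free open interval can be prolonged. -/
theorem exists_prolongation (h : IsHalfArcFun e φ) {q : ℝ → X} (hq : IsOpenEmbedding q) {β : ℝ}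
    (hcl : closure (φ ⁻¹' Ioo 0 1) = {x | φ x < 1} ∪ {q β})
    (hleft : q '' Iio β = φ ⁻¹' Ioo 0 1) :
    ∃ ψ, IsHalfArcFun e ψ ∧ ψ (q β) < 1 := by
  have he : e ∉ range q := h.base_notMem hq
  have hqlt : ∀ u, φ (q u) < 1 ↔ u < β := by
    intro u
    constructor
    · intro hu
      have : q u ∈ q '' Iio β := by
        rw [hleft]
        exact ⟨(h.nonneg _).lt_of_ne fun h0 => he ⟨u, h.eq_base h0.symm⟩, hu⟩
      obtain ⟨v, hv, hvu⟩ := this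
      exact hq.injective hvu ▸ hv
    · intro hu
      have : q u ∈ φ ⁻¹' Ioo 0 1 := hleft ▸ mem_image_of_mem q hu
      exact this.2
  let ψ : X → ℝ := fun x => if φ x < 1 then φ x / 2 else
    if ∃ u, u ≤ β + 1 ∧ q u = x then 1 / 2 + (Function.invFun q x - β) / 2 else 1
  have hψ1 : ∀ x, φ x < 1 → ψ x = φ x / 2 := fun x hx => if_pos hx
  have hψ2 : ∀ u, β ≤ u → u ≤ β + 1 → ψ (q u) = 1 / 2 + (u - β) / 2 := by
    intro u hu hu1
    have h1 : ¬ φ (q u) < 1 := by rw [hqlt]; exact not_lt.2 hu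
    simp only [ψ, if_neg h1, if_pos (⟨u, hu1, rfl⟩ : ∃ v, v ≤ β + 1 ∧ q v = q u),
      Function.leftInverse_invFun hq.injective u]
  have hψ3 : ∀ x, ¬ φ x < 1 → (¬ ∃ u, β ≤ u ∧ u ≤ β + 1 ∧ q u = x) → ψ x = 1 := by
    intro x hx hx'
    have : ¬ ∃ u, u ≤ β + 1 ∧ q u = x := by
      rintro ⟨u, hu, rfl⟩
      exact hx' ⟨u, not_lt.1 (by rwa [hqlt] at hx), hu, rfl⟩
    simp only [ψ, if_neg hx, if_neg this]
  have hcases : ∀ x, φ x < 1 ∨ (∃ u, β ≤ u ∧ u ≤ β + 1 ∧ q u = x) ∨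
      (¬ φ x < 1 ∧ ¬ ∃ u, β ≤ u ∧ u ≤ β + 1 ∧ q u = x) := fun x => by tauto
  have hlt : ∀ x r, 0 < r → r ≤ 1 →
      (ψ x < 1 / 2 + r / 2 ↔ φ x < 1 ∨ x ∈ q '' Iio (β + r)) := by
    intro x r hr0 hr1
    rcases hcases x with hx | ⟨u, hu, hu1, rfl⟩ | ⟨hx, hx'⟩
    · simp only [hψ1 x hx, hx, true_or, iff_true]
      linarith
    · rw [hψ2 u hu hu1, hqlt, hq.injective.mem_set_image, mem_Iio]
      constructor
      · intro hur; right; linarith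
      · rintro (hur | hur) <;> linarith
    · rw [hψ3 x hx hx']
      refine iff_of_false (by linarith) ?_
      rintro (hxx | ⟨u, hu, rfl⟩)
      · exact hx hxx
      · rw [hqlt] at hx
        exact hx' ⟨u, not_lt.1 hx, (le_of_lt hu).trans (by linarith), rfl⟩
  have hle : ∀ x r, 0 ≤ r → r < 1 →
      (ψ x ≤ 1 / 2 + r / 2 ↔ x ∈ closure (φ ⁻¹' Ioo 0 1) ∪ q '' Icc β (β + r)) := by
    intro x r hr0 hr1
    rw [hcl]
    rcases hcases x with hx | ⟨u, hu, hu1, rfl⟩ | ⟨hx, hx'⟩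
    · refine iff_of_true (by rw [hψ1 x hx]; linarith) (Or.inl (Or.inl hx))
    · rw [hψ2 u hu hu1]
      constructor
      · intro hur
        exact Or.inr ⟨u, ⟨hu, by linarith⟩, rfl⟩
      · rintro ((hur | hur) | ⟨v, hv, hvu⟩)
        · have := (hqlt u).1 hur; linarith
        · have := hq.injective hur; linarith
        · have := hq.injective hvu
          subst this
          linarith [hv.2]
    · rw [hψ3 x hx hx']
      refine iff_of_false (by linarith) ?_
      rintro ((hxx | hxx) | ⟨u, hu, rfl⟩)
      · exact hx hxx
      · exact hx' ⟨β, le_rfl, by linarith, hxx.symm⟩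
      · exact hx' ⟨u, hu.1, hu.2.trans (by linarith), rfl⟩
  have hhalf : ∀ x, ¬ φ x < 1 → 1 / 2 ≤ ψ x := by
    intro x hx
    rcases hcases x with hx' | ⟨u, hu, hu1, rfl⟩ | ⟨-, hx'⟩
    · exact absurd hx' hx
    · rw [hψ2 u hu hu1]; linarith
    · rw [hψ3 x hx hx']; norm_num
  have hψle : ∀ x, ψ x ≤ 1 := by
    intro x
    rcases hcases x with hx | ⟨u, hu, hu1, rfl⟩ | ⟨hx, hx'⟩
    · rw [hψ1 x hx]; linarith
    · rw [hψ2 u hu hu1]; linarith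
    · rw [hψ3 x hx hx']
  have hψnn : ∀ x, 0 ≤ ψ x := by
    intro x
    by_cases hx : φ x < 1
    · rw [hψ1 x hx]; linarith [h.nonneg x]
    · linarith [hhalf x hx]
  have hcont : Continuous ψ := by
    rw [continuous_iff_lower_upperSemicontinuous, lowerSemicontinuous_iff_isOpen_preimage,
      upperSemicontinuous_iff_isOpen_preimage]
    constructor
    · intro r
      rw [← isClosed_compl_iff]
      have hset : (ψ ⁻¹' Ioi r)ᶜ = {x | ψ x ≤ r} := by ext; simp
      rw [hset]
      rcases lt_or_ge r (1 / 2) with hr | hr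
      · have : {x | ψ x ≤ r} = {x | φ x ≤ 2 * r} := by
          ext x
          by_cases hx : φ x < 1
          · simp only [mem_ofPred_eq, hψ1 x hx]
            constructor <;> intro <;> linarith
          · simp only [mem_ofPred_eq]
            exact iff_of_false (by linarith [hhalf x hx]) (by linarith)
        rw [this]
        exact isClosed_le h.continuous continuous_const
      rcases lt_or_ge r 1 with hr1 | hr1
      · have : {x | ψ x ≤ r} = closure (φ ⁻¹' Ioo 0 1) ∪ q '' Icc β (β + (2 * r - 1)) := by
          ext x
          rw [← hle x (2 * r - 1) (by linarith) (by linarith), mem_ofPred_eq]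
          ring_nf
        rw [this]
        exact isClosed_closure.union (isCompact_Icc.image hq.continuous).isClosed
      · have : {x | ψ x ≤ r} = univ := eq_univ_of_forall fun x => (hψle x).trans hr1
        rw [this]
        exact isClosed_univ
    · intro r
      rcases le_or_gt r (1 / 2) with hr | hr
      · have : ψ ⁻¹' Iio r = {x | φ x < 2 * r} := by
          ext x
          by_cases hx : φ x < 1
          · simp only [mem_ofPred_eq, mem_preimage, mem_Iio, hψ1 x hx]
            constructor <;> intro <;> linarith
          · simp only [mem_ofPred_eq, mem_preimage, mem_Iio]
            exact iff_of_false (by linarith [hhalf x hx]) (by linarith)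
        rw [this]
        exact isOpen_lt h.continuous continuous_const
      rcases le_or_gt r 1 with hr1 | hr1
      · have : ψ ⁻¹' Iio r = {x | φ x < 1} ∪ q '' Iio (β + (2 * r - 1)) := by
          ext x
          have := hlt x (2 * r - 1) (by linarith) (by linarith)
          rw [mem_union, mem_ofPred_eq, ← this, mem_preimage, mem_Iio]
          ring_nf
        rw [this]
        exact (isOpen_lt h.continuous continuous_const).union (hq.isOpenMap _ isOpen_Iio)
      · have : ψ ⁻¹' Iio r = univ := eq_univ_of_forall fun x => (hψle x).trans_lt hr1
        rw [this]
        exact isOpen_univ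
  refine ⟨ψ, ⟨hcont, hψnn, hψle, ?_, ?_, ?_⟩, ?_⟩
  · rw [hψ1 e (by rw [h.map_base]; exact zero_lt_one), h.map_base, zero_div]
  · refine ⟨q (β + 1), ?_⟩
    rw [hψ2 (β + 1) (by linarith) le_rfl]; ring
  · intro x y hx hxy
    rcases hcases x with hx1 | ⟨u, hu, hu1, rfl⟩ | ⟨hx1, hx'⟩
    · rcases hcases y with hy1 | ⟨v, hv, hv1, rfl⟩ | ⟨hy1, hy'⟩
      · rw [hψ1 x hx1, hψ1 y hy1] at hxy
        exact h.inj x y hx1 (by linarith)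
      · rw [hψ1 x hx1, hψ2 v hv hv1] at hxy
        linarith
      · rw [hxy, hψ3 y hy1 hy'] at hx
        exact absurd hx (lt_irrefl _)
    · rcases hcases y with hy1 | ⟨v, hv, hv1, rfl⟩ | ⟨hy1, hy'⟩
      · rw [hψ2 u hu hu1, hψ1 y hy1] at hxy
        linarith
      · rw [hψ2 u hu hu1, hψ2 v hv hv1] at hxy
        congr 1
        linarith
      · rw [hxy, hψ3 y hy1 hy'] at hx
        exact absurd hx (lt_irrefl _)
    · rw [hψ3 x hx1 hx'] at hx
      exact absurd hx (lt_irrefl _)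
  · rw [hψ2 β le_rfl (by linarith)]; norm_num

theorem exists_prolongation_of_bddAbove (h : IsHalfArcFun e φ) {b : X}
    (hcl : closure (φ ⁻¹' Ioo 0 1) = {x | φ x < 1} ∪ {b})
    {q : ℝ → X} (hq : IsOpenEmbedding q) (hsub : φ ⁻¹' Ioo 0 1 ⊆ range q)
    (hb : BddAbove (q ⁻¹' (φ ⁻¹' Ioo 0 1))) :
    ∃ ψ, IsHalfArcFun e ψ ∧ ψ b < 1 := by
  set I := q ⁻¹' (φ ⁻¹' Ioo 0 1) with hI
  have hIo : IsOpen I := (isOpen_Ioo.preimage h.continuous).preimage hq.continuous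
  have hqI : q '' I = φ ⁻¹' Ioo 0 1 := image_preimage_eq_of_subset hsub
  have hIne : I.Nonempty := by
    obtain ⟨x, hx⟩ := h.exists_eq (r := 1 / 2) (by norm_num) (by norm_num)
    obtain ⟨u, rfl⟩ := hsub (show x ∈ φ ⁻¹' Ioo 0 1 by simp only [mem_preimage, hx]; norm_num)
    exact ⟨u, by simp only [hI, mem_preimage, hx]; norm_num⟩
  have hIc : I.OrdConnected := (IsPreconnected.preimage_of_isOpenMap (h.isPreconnected_preimage
      Ioo_subset_Ico_self isPreconnected_Ioo) hq.injective hq.isOpenMap hsub).ordConnected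
  have hbd : ∀ u ∈ closure I, u ∉ I → q u = b := by
    intro u hu huI
    have : q u ∈ closure (φ ⁻¹' Ioo 0 1) := by
      rw [← hqI]; exact image_closure_subset_closure_image hq.continuous ⟨u, hu, rfl⟩
    rw [hcl] at this
    rcases this with h1 | h1
    · refine absurd (⟨(h.nonneg _).lt_of_ne fun h0 => ?_, h1⟩ : u ∈ I) huI
      exact h.base_notMem hq ⟨u, h.eq_base h0.symm⟩
    · exact h1
  have hβ : q (sSup I) = b := hbd _ (csSup_mem_closure hIne hb) (hIo.csSup_notMem hb)
  have hIio : I = Iio (sSup I) := by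
    refine Subset.antisymm (fun u hu => (le_csSup hb hu).lt_of_ne fun heq =>
      hIo.csSup_notMem hb (heq ▸ hu)) fun u hu => ?_
    by_contra huI
    obtain ⟨i, hi, hui⟩ := exists_lt_of_lt_csSup hIne hu
    have hbb : BddBelow I := ⟨u, fun j hj => by
      by_contra! hju
      exact huI (hIc.out hj hi ⟨hju.le, hui.le⟩)⟩
    have hα : q (sInf I) = b := hbd _ (csInf_mem_closure hIne hbb) (hIo.csInf_notMem hbb)
    have heq := hq.injective (hα.trans hβ.symm)
    have h1 := csInf_le hbb hi
    have h2 := le_csSup hb hi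
    have h3 : i = sSup I := by linarith
    exact hIo.csSup_notMem hb (h3 ▸ hi)
  subst hβ
  exact h.exists_prolongation hq hcl (by rw [← hIio, hqI])

theorem isMaxFreeOpenInterval (h : IsHalfArcFun e φ) {b : X} (hb : φ b = 1)
    (hcl : closure (φ ⁻¹' Ioo 0 1) = {x | φ x < 1} ∪ {b})
    (hmax : ∀ ψ, IsHalfArcFun e ψ → {x | ψ x < 1} ⊆ {x | φ x < 1}) :
    IsMaxFreeOpenInterval (φ ⁻¹' Ioo 0 1) := by
  refine ⟨h.isFreeOpenInterval, fun K hK hsub => ?_⟩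
  obtain ⟨q, hq, rfl⟩ := hK.exists_isOpenEmbedding
  refine Subset.antisymm hsub ?_
  rintro _ ⟨w, rfl⟩
  by_contra hw
  have hfalse : ¬ ∃ ψ, IsHalfArcFun e ψ ∧ ψ b < 1 := by
    rintro ⟨ψ, hψ, hψb⟩
    exact absurd hb (ne_of_lt (hmax ψ hψ hψb))
  have hIc : (q ⁻¹' (φ ⁻¹' Ioo 0 1)).OrdConnected :=
    (IsPreconnected.preimage_of_isOpenMap (h.isPreconnected_preimage
      Ioo_subset_Ico_self isPreconnected_Ioo) hq.injective hq.isOpenMap hsub).ordConnected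
  by_cases hba : BddAbove (q ⁻¹' (φ ⁻¹' Ioo 0 1))
  · exact hfalse (h.exists_prolongation_of_bddAbove hcl hq hsub hba)
  · have hq' : IsOpenEmbedding (q ∘ Neg.neg) := hq.comp (Homeomorph.neg ℝ).isOpenEmbedding
    refine hfalse (h.exists_prolongation_of_bddAbove hcl hq' ?_ ?_)
    · rwa [neg_surjective.range_comp]
    · refine ⟨-w, fun u hu => ?_⟩
      by_contra! hlt
      obtain ⟨i, hi, hwi⟩ := not_bddAbove_iff.1 hba w
      exact hw (hIc.out hu hi ⟨by linarith, hwi.le⟩)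

theorem exists_isTypeI [LocallyConnectedSpace X] (h : IsHalfArcFun e φ) :
    ∃ J : Set X, IsTypeI J := by
  obtain ⟨Φ, hΦ, hmax⟩ := h.exists_maximal
  obtain ⟨b, hb, hcl⟩ := hΦ.exists_closure_eq
  refine ⟨_, hΦ.isMaxFreeOpenInterval hb hcl hmax, e, b, ?_, ?_, ?_, ?_, hΦ.isArcEnds hb hcl,
    Or.inl hΦ.isEndpointOf⟩
  · rintro rfl
    exact zero_ne_one (hΦ.map_base.symm.trans hb)
  · simp [hΦ.map_base]
  · simp [hb]
  · rw [hcl]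
    ext x
    simp only [mem_union, mem_ofPred_eq, mem_singleton_iff, mem_preimage, mem_Ioo, mem_insert_iff]
    constructor
    · rintro (hx | rfl)
      · rcases (hΦ.nonneg x).eq_or_lt with h0 | h0
        · exact Or.inr (Or.inl (hΦ.eq_base h0.symm))
        · exact Or.inl ⟨h0, hx⟩
      · simp
    · rintro (hx | rfl | rfl)
      · exact Or.inl hx.2
      · exact Or.inl (by rw [hΦ.map_base]; exact zero_lt_one)
      · simp

end IsHalfArcFun

/-! ### Open maps from the line -/

section OpenLine

variable {X : Type*} [MetricSpace X] [CompactSpace X] [ConnectedSpace X] {p : ℝ → X} {s t : ℝ}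

theorem closure_image_Ioo_subset (hc : Continuous p) (hp : p s = p t) (hst : s < t) :
    closure (p '' Ioo s t) ⊆ insert (p s) (p '' Ioo s t) := by
  refine (closure_minimal (image_mono Ioo_subset_Icc_self)
    (isCompact_Icc.image hc).isClosed).trans ?_
  rintro _ ⟨u, hu, rfl⟩
  rcases hu.1.eq_or_lt with rfl | h1
  · exact Or.inl rfl
  rcases hu.2.eq_or_lt with rfl | h2
  · exact Or.inl hp.symm
  · exact Or.inr ⟨u, ⟨h1, h2⟩, rfl⟩

/-- If the ends of an interval have the same image and this image is also attained inside, then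
the image of the interval is clopen. -/
theorem image_Ioo_eq_univ (hc : Continuous p) (ho : IsOpenMap p) (hst : s < t) (hp : p s = p t)
    (hmem : p s ∈ p '' Ioo s t) : p '' Ioo s t = univ := by
  have hcl : IsClosed (p '' Ioo s t) := isClosed_of_closure_subset
    ((closure_image_Ioo_subset hc hp hst).trans (insert_subset hmem subset_rfl))
  exact IsClopen.eq_univ ⟨hcl, ho _ isOpen_Ioo⟩ ((nonempty_Ioo.2 hst).image p)

/-- Near the left end of an interval whose ends have the same image, the image of the interval is
already covered by the right-hand germ. -/
theorem image_Ico_union_compl_mem_nhds (hc : Continuous p) (ho : IsOpenMap p) (hst : s < t)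
    (hp : p s = p t) (hmem : p s ∉ p '' Ioo s t) (hne : insert (p s) (p '' Ioo s t) ≠ univ)
    {η : ℝ} (hη : 0 < η) : p '' Ico s (s + η) ∪ (p '' Ioo s t)ᶜ ∈ 𝓝 (p s) := by
  set W := p '' Ioo s t with hW
  have hWo : IsOpen W := ho _ isOpen_Ioo
  have hWcl : closure W ⊆ insert (p s) W := closure_image_Ioo_subset hc hp hst
  have hWc : IsPreconnected W := isPreconnected_Ioo.image p hc.continuousOn
  obtain ⟨w, hw⟩ : W.Nonempty := (nonempty_Ioo.2 hst).image p
  suffices h : ∃ v < s, Disjoint (p '' Ioo v s) W by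
    obtain ⟨v, hv, hd⟩ := h
    refine Filter.mem_of_superset ((ho _ (isOpen_Ioo (a := v) (b := s + η))).mem_nhds
      ⟨s, ⟨hv, by linarith⟩, rfl⟩) ?_
    rintro _ ⟨u, hu, rfl⟩
    rcases lt_or_ge u s with hus | hus
    · exact Or.inr (disjoint_left.1 hd ⟨u, ⟨hu.1, hus⟩, rfl⟩)
    · exact Or.inl ⟨u, ⟨hus, hu.2⟩, rfl⟩
  have hpw : p s ≠ w := fun h => hmem (h ▸ hw)
  obtain ⟨η₁, hη₁, hball⟩ := Metric.mem_nhds_iff.1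
    (hc.continuousAt.preimage_mem_nhds (isOpen_compl_singleton.mem_nhds hpw))
  have hball' : ∀ u, s - η₁ < u → u < s + η₁ → p u ≠ w := fun u h1 h2 =>
    hball (show u ∈ ball s η₁ by rw [Real.ball_eq_Ioo]; exact ⟨h1, h2⟩)
  by_cases hv : ∃ v, s - η₁ < v ∧ v < s ∧ p v = p s
  · obtain ⟨v, hv1, hvs, hpv⟩ := hv
    refine ⟨v, hvs, ?_⟩
    rw [disjoint_iff_inter_eq_empty]
    by_contra hne'
    have hsub : W ⊆ p '' Ioo v s := by
      refine hWc.subset_of_closure_inter_subset (ho _ isOpen_Ioo)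
        (by rw [inter_comm]; exact nonempty_iff_ne_empty.2 hne') ?_
      rintro x ⟨hx, hxW⟩
      rcases closure_image_Ioo_subset hc hpv hvs hx with rfl | h
      · exact absurd (hpv ▸ hxW) hmem
      · exact h
    obtain ⟨u, hu, huw⟩ := hsub hw
    exact hball' u (by linarith [hu.1]) (by linarith [hu.2]) huw
  · push Not at hv
    refine ⟨s - η₁, by linarith, ?_⟩
    by_contra hnd
    obtain ⟨x, ⟨u, hu, hux⟩, hxW⟩ := not_disjoint_iff.1 hnd
    have hsub : p '' Ioo (s - η₁) s ⊆ W := by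
      refine (isPreconnected_Ioo.image p hc.continuousOn).subset_of_closure_inter_subset hWo
        ⟨x, ⟨u, hu, hux⟩, hxW⟩ ?_
      rintro _ ⟨hy, ⟨y, hyI, rfl⟩⟩
      rcases hWcl hy with h | h
      · exact absurd h (hv y hyI.1 hyI.2)
      · exact h
    have hop : IsOpen (insert (p s) W) := by
      have : insert (p s) W = W ∪ p '' Ioo (s - η₁) t := by
        ext x
        constructor
        · rintro (rfl | h)
          · exact Or.inr ⟨s, ⟨by linarith, hst⟩, rfl⟩
          · exact Or.inl h
        · rintro (h | ⟨y, hy, rfl⟩)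
          · exact Or.inr h
          · rcases lt_trichotomy y s with h | rfl | h
            · exact Or.inr (hsub ⟨y, ⟨hy.1, h⟩, rfl⟩)
            · exact Or.inl rfl
            · exact Or.inr ⟨y, ⟨h, hy.2⟩, rfl⟩
      rw [this]
      exact hWo.union (ho _ isOpen_Ioo)
    have hcl : IsClosed (insert (p s) W) := by
      refine isClosed_of_closure_subset ?_
      rw [insert_eq, closure_union, closure_singleton]
      exact union_subset subset_union_left (by rw [← insert_eq]; exact hWcl)
    exact hne (IsClopen.eq_univ ⟨hcl, hop⟩ ⟨_, mem_insert _ _⟩)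

theorem image_Ioc_union_compl_mem_nhds (hc : Continuous p) (ho : IsOpenMap p) (hst : s < t)
    (hp : p s = p t) (hmem : p s ∉ p '' Ioo s t) (hne : insert (p s) (p '' Ioo s t) ≠ univ)
    {η : ℝ} (hη : 0 < η) : p '' Ioc (t - η) t ∪ (p '' Ioo s t)ᶜ ∈ 𝓝 (p s) := by
  have h1 : (p ∘ Neg.neg) '' Ioo (-t) (-s) = p '' Ioo s t := by
    rw [image_comp, image_neg_eq_neg, neg_Ioo, neg_neg, neg_neg]
  have h2 : (p ∘ Neg.neg) '' Ico (-t) (-t + η) = p '' Ioc (t - η) t := by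
    rw [image_comp, image_neg_eq_neg, neg_Ico, neg_neg, neg_add, neg_neg, sub_eq_add_neg]
  have h3 : (p ∘ Neg.neg) (-t) = p s := by simp [hp]
  have := image_Ico_union_compl_mem_nhds (p := p ∘ Neg.neg) (s := -t) (t := -s)
    (hc.comp continuous_neg) (ho.comp (Homeomorph.neg ℝ).isOpenMap) (by linarith)
    (by simp [hp]) (by rwa [h1, h3]) (by rwa [h1, h3]) hη
  rwa [h1, h2, h3] at this

/-- A minimal pair of points with the same image makes the space a circle. -/
theorem spaceIsCircle_of_injOn (hc : Continuous p) (ho : IsOpenMap p) (hst : s < t)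
    (hp : p s = p t) (hinj : InjOn p (Ico s t)) : SpaceIsCircle X := by
  have hmem : p s ∉ p '' Ioo s t := by
    rintro ⟨u, hu, hus⟩
    exact hu.1.ne' (hinj ⟨hu.1.le, hu.2⟩ ⟨le_rfl, hst⟩ hus)
  have huniv : insert (p s) (p '' Ioo s t) = univ := by
    by_contra hne
    have hη : 0 < (t - s) / 2 := by linarith
    have h1 := image_Ico_union_compl_mem_nhds hc ho hst hp hmem hne hη
    have h2 := image_Ioc_union_compl_mem_nhds hc ho hst hp hmem hne hη
    have hcl : p s ∈ closure (p '' Ioo s t) :=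
      image_closure_subset_closure_image hc
        ⟨s, by rw [closure_Ioo hst.ne]; exact ⟨le_rfl, hst.le⟩, rfl⟩
    obtain ⟨x, ⟨hx1, hx2⟩, hxW⟩ := mem_closure_iff_nhds.1 hcl _ (Filter.inter_mem h1 h2)
    rcases hx1 with ⟨u, hu, rfl⟩ | hx1
    swap
    · exact hx1 hxW
    rcases hx2 with ⟨v, hv, hvu⟩ | hx2
    swap
    · exact hx2 hxW
    have hv1 := hv.1
    have hu2 := hu.2
    rcases hv.2.eq_or_lt with rfl | hvt
    · exact hmem (by rw [hp, hvu]; exact hxW)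
    · have := hinj ⟨by linarith, hvt⟩ ⟨hu.1, by linarith⟩ hvu
      linarith
  have hT : Fact (0 < t - s) := ⟨by linarith⟩
  have hp' : p s = p (s + (t - s)) := by rw [hp]; ring_nf
  let L : AddCircle (t - s) → X := AddCircle.liftIco (t - s) s p
  have hLc : Continuous L := AddCircle.liftIco_continuous hp' hc.continuousOn
  have hL : ∀ u ∈ Ico s t, L u = p u := fun u hu =>
    AddCircle.liftIco_coe_apply (by rwa [add_sub_cancel])
  have hrep : ∀ z : AddCircle (t - s), ∃ u ∈ Ico s t, (u : AddCircle (t - s)) = z := by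
    intro z
    have := AddCircle.coe_image_Ico_eq (t - s) s ▸ mem_univ z
    rwa [add_sub_cancel] at this
  have hbij : Function.Bijective L := by
    constructor
    · intro z w hzw
      obtain ⟨u, hu, rfl⟩ := hrep z
      obtain ⟨v, hv, rfl⟩ := hrep w
      rw [hL u hu, hL v hv] at hzw
      rw [hinj hu hv hzw]
    · intro x
      have hx : x ∈ insert (p s) (p '' Ioo s t) := huniv ▸ mem_univ x
      rcases hx with rfl | ⟨u, hu, rfl⟩
      · exact ⟨s, hL s ⟨le_rfl, hst⟩⟩
      · exact ⟨u, hL u ⟨hu.1.le, hu.2⟩⟩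
  let H : AddCircle (t - s) ≃ₜ X :=
    (Equiv.ofBijective L hbij).toHomeomorphOfContinuousClosed hLc hLc.isClosedMap
  exact ⟨H.symm.trans (AddCircle.homeomorphCircle (by linarith : t - s ≠ 0))⟩

/-- If an open map from the line folds an interval and misses a point there, then the space has a
half-arc, based at the image of a turning point of the map. -/
theorem exists_isHalfArcFun_of_fold (hc : Continuous p) (ho : IsOpenMap p) (hst : s < t)
    (hp : p s = p t) {w : X} (hw : w ∉ p '' Icc s t) :
    ∃ (e : X) (φ : X → ℝ), IsHalfArcFun e φ := by
  have hmem : ∀ a b, s ≤ a → a < b → b ≤ t → p a = p b → p a ∉ p '' Ioo a b := by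
    intro a b ha hab hb hpab h
    have := image_Ioo_eq_univ hc ho hab hpab h
    exact hw (image_mono (Ioo_subset_Icc_self.trans (Icc_subset_Icc ha hb)) (this ▸ mem_univ w))
  have hne : ∀ a b, s ≤ a → a < b → b ≤ t → insert (p a) (p '' Ioo a b) ≠ univ := by
    intro a b ha hab hb h
    have hwm : w ∈ insert (p a) (p '' Ioo a b) := h ▸ mem_univ w
    rcases hwm with rfl | h'
    · exact hw ⟨a, ⟨ha, hab.le.trans hb⟩, rfl⟩
    · exact hw (image_mono (Ioo_subset_Icc_self.trans (Icc_subset_Icc ha hb)) h')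
  have h3 : ∀ x y z, s ≤ x → x < y → y < z → z ≤ t → p x = p y → p x ≠ p z :=
    fun x y z hx hxy hyz hz h1 h2 => hmem x z hx (hxy.trans hyz) hz h2 ⟨y, ⟨hxy, hyz⟩, h1.symm⟩
  set S : Set ℝ := {x | x ∈ Icc s t ∧ ∀ y, x < y → y ≤ t → p y ≠ p x} with hS
  have htS : t ∈ S := ⟨⟨hst.le, le_rfl⟩, fun y h1 h2 => absurd h1 h2.not_gt⟩
  have hSb : BddBelow S := ⟨s, fun x hx => hx.1.1⟩
  set σ := sInf S with hσdef
  have hsσ' : s ≤ σ := le_csInf ⟨t, htS⟩ fun x hx => hx.1.1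
  have hσt : σ ≤ t := csInf_le hSb htS
  have hT : ∀ x, s ≤ x → x < σ → ∃ y, x < y ∧ y ≤ t ∧ p y = p x := by
    intro x hx hxσ
    have hxS := notMem_of_lt_csInf hxσ hSb
    by_contra! hcon
    exact hxS ⟨⟨hx, hxσ.le.trans hσt⟩, hcon⟩
  have hσ : ∀ y, σ < y → y ≤ t → p y ≠ p σ := by
    intro y hy hyt hpy
    have hN := image_Ioc_union_compl_mem_nhds hc ho hy hpy.symm (hmem σ y hsσ' hy hyt hpy.symm)
      (hne σ y hsσ' hy hyt) (η := (y - σ) / 2) (by linarith)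
    obtain ⟨ξ, hξ, hball⟩ := Metric.mem_nhds_iff.1 (hc.continuousAt.preimage_mem_nhds hN)
    rw [Real.ball_eq_Ioo] at hball
    obtain ⟨x, hxS, hx⟩ := exists_lt_of_csInf_lt ⟨t, htS⟩
      (show sInf S < σ + min ξ ((y - σ) / 2) by
        have : 0 < min ξ ((y - σ) / 2) := lt_min hξ (by linarith)
        linarith)
    have hσx : σ ≤ x := csInf_le hSb hxS
    have hx1 := min_le_left ξ ((y - σ) / 2)
    have hx2 := min_le_right ξ ((y - σ) / 2)
    rcases hσx.eq_or_lt with heq | hlt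
    · exact hxS.2 y (heq ▸ hy) hyt (heq ▸ hpy)
    rcases @hball x ⟨by linarith, by linarith⟩ with ⟨v, hv, hvx⟩ | h
    · exact hxS.2 v (by linarith [hv.1]) (hv.2.trans hyt) hvx
    · exact h ⟨x, ⟨hlt, by linarith⟩, rfl⟩
  have hsσ : s < σ := by
    rcases hsσ'.eq_or_lt with h | h
    · exact absurd hp.symm (h ▸ hσ t (h ▸ hst) le_rfl)
    · exact h
  have hA : ∀ x x', s ≤ x → x < x' → x' < σ → p x ≠ p x' := by
    intro x x' hx hxx' hx' h
    obtain ⟨z, hz, hzt, hpz⟩ := hT x' (hx.trans hxx'.le) hx'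
    exact h3 x x' z hx hxx' hz hzt h (h.trans hpz.symm)
  have hB : ∀ x, s ≤ x → x < σ → p x ≠ p σ := by
    intro x hx hxσ h
    have hN := image_Ico_union_compl_mem_nhds hc ho hxσ h (hmem x σ hx hxσ hσt h)
      (hne x σ hx hxσ hσt) (η := (σ - x) / 2) (by linarith)
    rw [h] at hN
    obtain ⟨ξ, hξ, hball⟩ := Metric.mem_nhds_iff.1 (hc.continuousAt.preimage_mem_nhds hN)
    rw [Real.ball_eq_Ioo] at hball
    have hm : 0 < min ξ ((σ - x) / 2) := lt_min hξ (by linarith)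
    have hx1 := min_le_left ξ ((σ - x) / 2)
    have hx2 := min_le_right ξ ((σ - x) / 2)
    obtain ⟨u, hu1, hu2⟩ := exists_between (sub_lt_self σ hm)
    rcases @hball u ⟨by linarith, by linarith⟩ with ⟨v, hv, hvu⟩ | h'
    · exact hA v u (hx.trans hv.1) (by linarith [hv.2]) hu2 hvu
    · exact h' ⟨u, ⟨by linarith, hu2⟩, rfl⟩
  have hpart : ∀ x, s ≤ x → x < σ → ∃ y, σ < y ∧ y ≤ t ∧ p y = p x := by
    intro x hx hxσ
    obtain ⟨y, hxy, hyt, hpy⟩ := hT x hx hxσ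
    refine ⟨y, ?_, hyt, hpy⟩
    rcases lt_trichotomy y σ with h | h | h
    · exact absurd hpy.symm (hA x y hx hxy h)
    · exact absurd (h ▸ hpy.symm) (hB x hx hxσ)
    · exact h
  have hinj : ∀ x ∈ Icc s σ, ∀ y ∈ Icc s σ, p x = p y → x = y := by
    have key : ∀ x y, s ≤ x → x < y → y ≤ σ → p x ≠ p y := by
      intro x y hx hxy hy
      rcases hy.eq_or_lt with rfl | hy
      · exact hB x hx hxy
      · exact hA x y hx hxy hy
    intro x hx y hy h
    rcases lt_trichotomy x y with h' | h' | h'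
    · exact absurd h (key x y hx.1 h' hy.2)
    · exact h'
    · exact absurd h.symm (key y x hy.1 h' hx.2)
  have hopen : ∀ x, s ≤ x → x < σ → IsOpen (p '' Ioc x σ) := by
    intro x hx hxσ
    obtain ⟨y, hσy, hyt, hpy⟩ := hpart x hx hxσ
    have hxy := hxσ.trans hσy
    have hG : IsClosed (p ⁻¹' (p '' Icc x σ)) := (isCompact_Icc.image hc).isClosed.preimage hc
    have hcov : ∀ u, σ < u → u ≤ y → p u ∈ p '' Icc x σ := by
      intro u hu huy
      have hsub : Icc u y ⊆ p ⁻¹' (p '' Icc x σ) := by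
        refine IsClosed.Icc_subset_of_forall_exists_lt (hG.inter isClosed_Icc)
          ⟨x, ⟨le_rfl, hxσ.le⟩, hpy.symm⟩ ?_
        rintro v ⟨hvG, hv⟩ v' hv'
        have hv'v : v' < v := hv'
        suffices hN : ∀ᶠ a in 𝓝[<] v, a ∈ p ⁻¹' (p '' Icc x σ) by
          obtain ⟨a, ha, ha'⟩ := (hN.and (Ico_mem_nhdsLT hv'v)).exists
          exact ⟨a, ha, ha'⟩
        rcases hv.2.eq_or_lt with rfl | hvy
        · have hN := image_Ico_union_compl_mem_nhds hc ho hxy hpy.symm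
            (hmem x v hx hxy hyt hpy.symm) (hne x v hx hxy hyt) (η := σ - x) (by linarith)
          rw [← hpy] at hN
          filter_upwards [nhdsWithin_le_nhds (hc.continuousAt.preimage_mem_nhds hN),
            Ioo_mem_nhdsLT hxy] with a ha ha'
          rcases ha with ⟨b, hb, hba⟩ | ha
          · exact ⟨b, ⟨hb.1, by linarith [hb.2]⟩, hba⟩
          · exact absurd ⟨a, ha', rfl⟩ ha
        · obtain ⟨b, hb, hbv⟩ := hvG
          have hσv : σ < v := hu.trans_le hv.1.le
          have hbx : x < b := by
            refine lt_of_le_of_ne hb.1 ?_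
            rintro rfl
            exact h3 x v y hx (hxσ.trans hσv) hvy hyt hbv hpy.symm
          have hbσ : b < σ := by
            refine lt_of_le_of_ne hb.2 ?_
            rintro rfl
            exact hσ v hσv (hvy.le.trans hyt) hbv.symm
          have hN : p '' Ioo x σ ∈ 𝓝 (p v) :=
            (ho _ isOpen_Ioo).mem_nhds ⟨b, ⟨hbx, hbσ⟩, hbv⟩
          filter_upwards [nhdsWithin_le_nhds (hc.continuousAt.preimage_mem_nhds hN)] with a ha
          exact image_mono Ioo_subset_Icc_self ha
      exact hsub ⟨le_rfl, huy⟩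
    have heq : p '' Ioc x σ = p '' Ioo x y := by
      refine Subset.antisymm (image_mono fun a ha => ⟨ha.1, ha.2.trans_lt hσy⟩) ?_
      rintro _ ⟨u, hu, rfl⟩
      rcases le_or_gt u σ with h | h
      · exact ⟨u, ⟨hu.1, h⟩, rfl⟩
      · obtain ⟨b, hb, hbu⟩ := hcov u h hu.2.le
        refine ⟨b, ⟨lt_of_le_of_ne hb.1 ?_, hb.2⟩, hbu⟩
        rintro rfl
        exact h3 x u y hx hu.1 hu.2 hyt hbu hpy.symm
    rw [heq]
    exact ho _ isOpen_Ioo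
  classical
  let φ : X → ℝ := fun z => if h : ∃ u ∈ Icc s σ, p u = z then (σ - h.choose) / (σ - s) else 1
  have hpos : 0 < σ - s := by linarith
  have hφ : ∀ u ∈ Icc s σ, φ (p u) = (σ - u) / (σ - s) := by
    intro u hu
    have h : ∃ v ∈ Icc s σ, p v = p u := ⟨u, hu, rfl⟩
    have := hinj _ h.choose_spec.1 u hu h.choose_spec.2
    simp only [φ, dif_pos h, this]
  have hφ1 : ∀ z, z ∉ p '' Icc s σ → φ z = 1 := fun z hz => dif_neg hz
  have hcases : ∀ z, φ z = 1 ∨ ∃ u ∈ Ioc s σ, p u = z ∧ φ z = (σ - u) / (σ - s) := by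
    intro z
    by_cases hz : z ∈ p '' Icc s σ
    · obtain ⟨u, hu, rfl⟩ := hz
      rcases hu.1.eq_or_lt with rfl | h
      · left
        rw [hφ _ hu, div_self hpos.ne']
      · exact Or.inr ⟨u, ⟨h, hu.2⟩, rfl, hφ _ hu⟩
    · exact Or.inl (hφ1 z hz)
  have h0 : ∀ z, 0 ≤ φ z := by
    intro z
    rcases hcases z with h | ⟨u, hu, -, h⟩
    · rw [h]; exact zero_le_one
    · rw [h]; exact div_nonneg (by linarith [hu.2]) hpos.le
  have h1 : ∀ z, φ z ≤ 1 := by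
    intro z
    rcases hcases z with h | ⟨u, hu, -, h⟩
    · rw [h]
    · rw [h, div_le_one hpos]; linarith [hu.1]
  refine ⟨p σ, φ, ?_, h0, h1, ?_, ⟨p s, ?_⟩, ?_⟩
  · rw [continuous_iff_lower_upperSemicontinuous]
    constructor
    · rw [lowerSemicontinuous_iff_isClosed_preimage]
      intro r
      rcases lt_or_ge r 0 with hr | hr
      · convert isClosed_empty
        exact eq_empty_of_forall_notMem fun z hz => absurd (h0 z) (not_le.2 (lt_of_le_of_lt hz hr))
      rcases le_or_gt 1 r with hr1 | hr1
      · convert isClosed_univ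
        exact eq_univ_of_forall fun z => (h1 z).trans hr1
      · convert (isCompact_Icc (a := σ - r * (σ - s)) (b := σ)).image hc |>.isClosed using 1
        ext z
        constructor
        · intro hz
          have hz' : φ z ≤ r := hz
          rcases hcases z with h | ⟨u, hu, rfl, h⟩
          · linarith
          · rw [h, div_le_iff₀ hpos] at hz'
            exact ⟨u, ⟨by linarith, hu.2⟩, rfl⟩
        · rintro ⟨u, hu, rfl⟩
          have : r * (σ - s) ≤ σ - s := by nlinarith
          change φ (p u) ≤ r
          rw [hφ u ⟨by linarith [hu.1], hu.2⟩, div_le_iff₀ hpos]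
          linarith [hu.1]
    · rw [upperSemicontinuous_iff_isOpen_preimage]
      intro r
      rcases le_or_gt r 0 with hr | hr
      · convert isOpen_empty
        exact eq_empty_of_forall_notMem fun z hz => absurd (h0 z) (not_le.2 (lt_of_lt_of_le hz hr))
      rcases lt_or_ge 1 r with hr1 | hr1
      · convert isOpen_univ
        exact eq_univ_of_forall fun z => (h1 z).trans_lt hr1
      · have hle : r * (σ - s) ≤ σ - s := by nlinarith
        convert hopen (σ - r * (σ - s)) (by linarith) (by nlinarith) using 1
        ext z
        constructor
        · intro hz
          have hz' : φ z < r := hz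
          rcases hcases z with h | ⟨u, hu, rfl, h⟩
          · linarith
          · rw [h, div_lt_iff₀ hpos] at hz'
            exact ⟨u, ⟨by linarith, hu.2⟩, rfl⟩
        · rintro ⟨u, hu, rfl⟩
          change φ (p u) < r
          rw [hφ u ⟨by linarith [hu.1], hu.2⟩, div_lt_iff₀ hpos]
          linarith [hu.1]
  · rw [hφ σ ⟨hsσ.le, le_rfl⟩]; simp
  · rw [hφ s ⟨le_rfl, hsσ.le⟩, div_self hpos.ne']
  · intro x y hx hxy
    rcases hcases x with h | ⟨u, hu, rfl, h⟩
    · linarith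
    rcases hcases y with h' | ⟨v, hv, rfl, h'⟩
    · linarith
    rw [h, h', div_left_inj' hpos.ne'] at hxy
    rw [show u = v by linarith]

/-- An open map from the line into a space without maximal free open intervals of Type I is locally
injective. -/
theorem exists_injOn_Ioo [LocallyConnectedSpace X] [Nontrivial X] (hc : Continuous p)
    (ho : IsOpenMap p) (hnoI : ∀ J : Set X, ¬ IsTypeI J) (τ : ℝ) :
    ∃ η > 0, InjOn p (Ioo (τ - η) (τ + η)) := by
  obtain ⟨w, hw⟩ := exists_ne (p τ)
  obtain ⟨η, hη, hball⟩ := Metric.mem_nhds_iff.1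
    (hc.continuousAt.preimage_mem_nhds (isOpen_compl_singleton.mem_nhds hw.symm))
  rw [Real.ball_eq_Ioo] at hball
  have key : ∀ s t, τ - η < s → t < τ + η → s < t → p s ≠ p t := by
    intro s t hs ht hst hp
    obtain ⟨e, φ, h⟩ := exists_isHalfArcFun_of_fold hc ho hst hp (w := w) (by
      rintro ⟨u, hu, rfl⟩
      exact hball ⟨hs.trans_le hu.1, hu.2.trans_lt ht⟩ rfl)
    obtain ⟨J, hJ⟩ := h.exists_isTypeI
    exact hnoI J hJ
  refine ⟨η, hη, fun x hx y hy h => ?_⟩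
  rcases lt_trichotomy x y with h' | h' | h'
  · exact absurd h (key x y hx.1 hy.2 h')
  · exact h'
  · exact absurd h.symm (key y x hy.1 hx.2 h')

/-- An open map from the line into a space which is not a circle and has no maximal free open
interval of Type I is injective. -/
theorem injective_of_isOpenMap [LocallyConnectedSpace X] [Nontrivial X] (hc : Continuous p)
    (ho : IsOpenMap p) (hnoI : ∀ J : Set X, ¬ IsTypeI J) (hcirc : ¬ SpaceIsCircle X) :
    Function.Injective p := by
  have key : ∀ a b, a < b → p a ≠ p b := by
    intro a b hab hp
    choose η hη hinj using exists_injOn_Ioo hc ho hnoI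
    let O : Set (ℝ × ℝ) := ⋃ τ, Ioo (τ - η τ) (τ + η τ) ×ˢ Ioo (τ - η τ) (τ + η τ)
    have hO : IsOpen O := isOpen_iUnion fun τ => isOpen_Ioo.prod isOpen_Ioo
    let M : Set (ℝ × ℝ) := {z | a ≤ z.1 ∧ z.1 ≤ z.2 ∧ z.2 ≤ b ∧ p z.1 = p z.2} \ O
    have hMc : IsClosed M := by
      refine IsClosed.sdiff ?_ hO
      exact (isClosed_le continuous_const continuous_fst).inter
        ((isClosed_le continuous_fst continuous_snd).inter
          ((isClosed_le continuous_snd continuous_const).inter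
            (isClosed_eq (hc.comp continuous_fst) (hc.comp continuous_snd))))
    have hMk : IsCompact M := (isCompact_Icc.prod isCompact_Icc).of_isClosed_subset
      (s := Icc a b ×ˢ Icc a b) hMc fun z hz =>
        ⟨⟨hz.1.1, hz.1.2.1.trans hz.1.2.2.1⟩, ⟨hz.1.1.trans hz.1.2.1, hz.1.2.2.1⟩⟩
    have hM : ∀ x y, a ≤ x → x < y → y ≤ b → p x = p y → (x, y) ∈ M := by
      refine fun x y hx hxy hy h => ⟨⟨hx, hxy.le, hy, h⟩, fun hmem => ?_⟩
      obtain ⟨τ, h1, h2⟩ := mem_iUnion.1 hmem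
      exact hxy.ne (hinj τ h1 h2 h)
    obtain ⟨⟨s, t⟩, hst, hmin⟩ := hMk.exists_isMinOn ⟨_, hM a b le_rfl hab le_rfl hp⟩
      (continuous_snd.sub continuous_fst).continuousOn
    obtain ⟨⟨has, hst', htb, hpst⟩, hnO⟩ := hst
    have hlt : s < t := by
      refine lt_of_le_of_ne hst' ?_
      rintro rfl
      exact hnO (mem_iUnion.2 ⟨s, ⟨by linarith [hη s], by linarith [hη s]⟩,
        ⟨by linarith [hη s], by linarith [hη s]⟩⟩)
    have hmin' : ∀ x y, s ≤ x → x < y → y < t → p x ≠ p y := by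
      intro x y hx hxy hy h
      have : t - s ≤ y - x := hmin (hM x y (has.trans hx) hxy (hy.le.trans htb) h)
      linarith
    refine hcirc (spaceIsCircle_of_injOn hc ho hlt hpst fun x hx y hy h => ?_)
    rcases lt_trichotomy x y with h' | h' | h'
    · exact absurd h (hmin' x y hx.1 h' hy.2)
    · exact h'
    · exact absurd h.symm (hmin' y x hy.1 h' hx.2)
  intro x y h
  rcases lt_trichotomy x y with h' | h' | h'
  · exact absurd h (key x y h')
  · exact h'
  · exact absurd h.symm (key y x h')

end OpenLine

/-! ### Sensitive commutative semigroups of open maps -/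

section Sensitive

variable {X : Type*}

theorem isPreconnected_of_forall_isArcEnds [TopologicalSpace X] {s : Set X}
    (h : ∀ x ∈ s, ∀ y ∈ s, x ≠ y → ∃ A : Set X, A ⊆ s ∧ IsArcEnds A x y) : IsPreconnected s := by
  refine isPreconnected_of_forall_pair fun x hx y hy => ?_
  rcases eq_or_ne x y with rfl | hxy
  · exact ⟨{x}, singleton_subset_iff.2 hx, rfl, rfl, isPreconnected_singleton⟩
  · obtain ⟨A, hA, γ, hγ, -, rfl, rfl, rfl⟩ := h x hx y hy hxy
    exact ⟨_, hA, ⟨0, by simp, rfl⟩, ⟨1, by simp, rfl⟩, isPreconnected_Icc.image γ hγ⟩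

/-- A long open interval in `X` contains a member of any cover by small connected sets. -/
theorem exists_subset_image_Ioo [MetricSpace X] [CompactSpace X] {ι : Type*} {U : ι → Set X}
    {γ : ℝ → X} {a b ε : ℝ} (hγ : IsOpenEmbedding γ) (hab : a < b)
    (hdiam : 4 * ε < diam (γ '' Ioo a b)) (hUc : ∀ i, IsPreconnected (U i))
    (hUcover : ⋃ i, U i = univ) (hUdiam : ∀ i, diam (U i) < ε) :
    ∃ i, (U i).Nonempty ∧ U i ⊆ γ '' Ioo a b := by
  have hle : ∀ i, ∀ x ∈ U i, ∀ y ∈ U i, dist x y < ε := fun i x hx y hy =>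
    (dist_le_diam_of_mem isBounded_of_compactSpace hx hy).trans_lt (hUdiam i)
  have hε : 0 < ε := by
    obtain ⟨i, -⟩ := mem_iUnion.1 (hUcover ▸ mem_univ (γ a))
    exact diam_nonneg.trans_lt (hUdiam i)
  have hcl : closure (Ioo a b) = Icc a b := closure_Ioo hab.ne
  have ha : γ a ∈ closure (γ '' Ioo a b) := image_closure_subset_closure_image hγ.continuous
    ⟨a, hcl ▸ left_mem_Icc.2 hab.le, rfl⟩
  have hb : γ b ∈ closure (γ '' Ioo a b) := image_closure_subset_closure_image hγ.continuous
    ⟨b, hcl ▸ right_mem_Icc.2 hab.le, rfl⟩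
  obtain ⟨y, hy, hya, hyb⟩ : ∃ y ∈ γ '' Ioo a b, ε ≤ dist y (γ a) ∧ ε ≤ dist y (γ b) := by
    by_contra! hcon
    refine hdiam.not_ge (diam_le_of_forall_dist_le (by positivity) ?_)
    have hPQ : dist (γ a) (γ b) < 2 * ε := by
      by_contra! hfar
      have hdisj : Disjoint (ball (γ a) ε) (ball (γ b) ε) := ball_disjoint_ball (by linarith)
      obtain ⟨z, -, hz⟩ := isPreconnected_Ioo.image γ hγ.continuous.continuousOn _ _
        isOpen_ball isOpen_ball
        (fun y hy => (lt_or_ge (dist y (γ a)) ε).imp id (hcon y hy))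
        (inter_comm _ _ ▸ mem_closure_iff.1 ha _ isOpen_ball (mem_ball_self hε))
        (inter_comm _ _ ▸ mem_closure_iff.1 hb _ isOpen_ball (mem_ball_self hε))
      exact disjoint_left.1 hdisj hz.1 hz.2
    have hnear : ∀ x ∈ γ '' Ioo a b, dist x (γ a) < ε ∨ dist x (γ b) < ε :=
      fun x hx => (lt_or_ge (dist x (γ a)) ε).imp id (hcon x hx)
    intro x hx y hy
    have h1 := dist_triangle_right x y (γ a)
    have h2 := dist_triangle_right x y (γ b)
    have h3 := dist_triangle4 x (γ a) (γ b) y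
    have h4 := dist_triangle4 x (γ b) (γ a) y
    rw [dist_comm (γ b) y] at h3
    rw [dist_comm (γ a) y, dist_comm (γ b) (γ a)] at h4
    rcases hnear x hx with h | h <;> rcases hnear y hy with h' | h' <;> linarith
  obtain ⟨i, hi⟩ := mem_iUnion.1 (hUcover ▸ mem_univ y)
  refine ⟨i, ⟨y, hi⟩, (hUc i).subset_of_closure_inter_subset (hγ.isOpenMap _ isOpen_Ioo)
    ⟨y, hi, hy⟩ ?_⟩
  rintro x ⟨hx, hxi⟩
  obtain ⟨u, hu, rfl⟩ := closure_minimal (image_mono Ioo_subset_Icc_self)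
    (isCompact_Icc.image hγ.continuous).isClosed hx
  rcases hu.1.eq_or_lt with rfl | h1
  · exact absurd (hle i y hi _ hxi) hya.not_gt
  rcases hu.2.eq_or_lt with rfl | h2
  · exact absurd (hle i y hi _ hxi) hyb.not_gt
  · exact ⟨u, ⟨h1, h2⟩, rfl⟩

/-- The open interval `γ '' Ioo a b` is moved off itself, inside the line `γ`, by every map in
`L`. -/
structure IsJumping [TopologicalSpace X] (L : Set (X → X)) (γ : ℝ → X) (a b : ℝ) : Prop where
  isOpenEmbedding : IsOpenEmbedding γ
  lt : a < b
  image_subset : ∀ f ∈ L, f '' (γ '' Ioo a b) ⊆ range γ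
  disjoint : ∀ f ∈ L, Disjoint (f '' (γ '' Ioo a b)) (γ '' Ioo a b)

variable [TopologicalSpace X] {F L : Set (X → X)} {ι : Type*} [Fintype ι] {U : ι → Set X}
  {γ : ℝ → X} {a b : ℝ}

theorem IsJumping.comp (hJ : IsJumping L γ a b) {h : X → X} (hh : IsOpenEmbedding (h ∘ γ))
    (hcomm : ∀ f ∈ L, h ∘ f = f ∘ h) : IsJumping L (h ∘ γ) a b := by
  have heq : ∀ f ∈ L, f '' ((h ∘ γ) '' Ioo a b) = h '' (f '' (γ '' Ioo a b)) := by
    intro f hf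
    rw [← image_comp, ← image_comp, ← image_comp, ← Function.comp_assoc, ← hcomm f hf,
      Function.comp_assoc]
  refine ⟨hh, hJ.lt, fun f hf => ?_, fun f hf => ?_⟩
  · rw [heq f hf, range_comp]
    exact image_mono (hJ.image_subset f hf)
  · rw [heq f hf, image_comp]
    have hinj : InjOn h (range γ) := by
      rintro _ ⟨u, rfl⟩ _ ⟨v, rfl⟩ huv
      rw [hh.injective huv]
    rw [disjoint_iff_inter_eq_empty, ← hinj.image_inter (hJ.image_subset f hf)
      (image_subset_range _ _), (hJ.disjoint f hf).inter_eq, image_empty]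

theorem IsJumping.mono (hJ : IsJumping L γ a b) {a' b' : ℝ} (hlt : a' < b')
    (hsub : Ioo a' b' ⊆ Ioo a b) : IsJumping L γ a' b' :=
  ⟨hJ.isOpenEmbedding, hlt,
    fun f hf => (image_mono (image_mono hsub)).trans (hJ.image_subset f hf),
    fun f hf => (hJ.disjoint f hf).mono (image_mono (image_mono hsub)) (image_mono hsub)⟩

/-- By the pigeonhole principle, some cover member `U i` inside a jumping interval has a point
which is moved, within `U i`, by a map in the semigroup. -/
theorem IsJumping.exists_return (hemb : ∀ h ∈ F, ∀ γ : ℝ → X, IsOpenEmbedding γ →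
      IsOpenEmbedding (h ∘ γ))
    (hexp : ∀ γ : ℝ → X, IsOpenEmbedding γ → ∀ a b, a < b →
      ∃ h ∈ F, ∃ i, (U i).Nonempty ∧ U i ⊆ (h ∘ γ) '' Ioo a b)
    (hUopen : ∀ i, IsOpen (U i)) (hsemi : ∀ f ∈ F, ∀ g ∈ F, f ∘ g ∈ F)
    (hcomm : ∀ f ∈ F, ∀ g ∈ F, f ∘ g = g ∘ f) (hLF : L ⊆ F) (hJ : IsJumping L γ a b) :
    ∃ γ' a' b', IsJumping L γ' a' b' ∧ ∃ i, U i ⊆ γ' '' Ioo a' b' ∧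
      ∃ G ∈ F, ∃ x ∈ U i, G x ∈ U i ∧ G x ≠ x := by
  classical
  suffices key : ∀ (k : ℕ) (T : Finset ι), Fintype.card ι ≤ T.card + k → ∀ (γ : ℝ → X) (a b : ℝ),
      IsJumping L γ a b → (∀ i ∈ T, ∃ (g : X → X) (V : Set X), (g = id ∨ g ∈ F) ∧ V ⊆ U i ∧
        ¬ U i ⊆ V ∧ γ '' Ioo a b ⊆ g '' V) →
      ∃ γ' a' b', IsJumping L γ' a' b' ∧ ∃ i, U i ⊆ γ' '' Ioo a' b' ∧
        ∃ G ∈ F, ∃ x ∈ U i, G x ∈ U i ∧ G x ≠ x from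
    key (Fintype.card ι) ∅ (by simp) γ a b hJ (by simp)
  have step : ∀ (T : Finset ι) (γ : ℝ → X) (a b : ℝ), IsJumping L γ a b →
      (∀ i ∈ T, ∃ (g : X → X) (V : Set X), (g = id ∨ g ∈ F) ∧ V ⊆ U i ∧
        ¬ U i ⊆ V ∧ γ '' Ioo a b ⊆ g '' V) →
      ∃ (γ' : ℝ → X) (i : ι), (i ∈ T → ∃ a' b', IsJumping L γ' a' b' ∧ ∃ i, U i ⊆ γ' '' Ioo a' b' ∧
        ∃ G ∈ F, ∃ x ∈ U i, G x ∈ U i ∧ G x ≠ x) ∧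
      ∃ a' b', IsJumping L γ' a' b' ∧ ∀ j ∈ insert i T, ∃ (g : X → X) (V : Set X),
        (g = id ∨ g ∈ F) ∧ V ⊆ U j ∧ ¬ U j ⊆ V ∧ γ' '' Ioo a' b' ⊆ g '' V := by
    intro T γ a b hJ hrec
    obtain ⟨h, hh, i, ⟨y, hy⟩, hi⟩ := hexp γ hJ.isOpenEmbedding a b hJ.lt
    have hγ' := hemb h hh γ hJ.isOpenEmbedding
    have hJ' : IsJumping L (h ∘ γ) a b := hJ.comp hγ' fun f hf => hcomm h hh f (hLF hf)
    have hrec' : ∀ j ∈ T, ∃ g ∈ F, ∃ V : Set X, V ⊆ U j ∧ ¬ U j ⊆ V ∧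
        (h ∘ γ) '' Ioo a b ⊆ g '' V := by
      intro j hj
      obtain ⟨g, V, hg, hV, hV', hsub⟩ := hrec j hj
      refine ⟨h ∘ g, ?_, V, hV, hV', ?_⟩
      · rcases hg with rfl | hg
        · exact hh
        · exact hsemi h hh g hg
      · rw [image_comp, image_comp]
        exact image_mono hsub
    refine ⟨h ∘ γ, i, fun hiT => ⟨a, b, hJ', i, hi, ?_⟩, ?_⟩
    · obtain ⟨G, hG, V, hV, hV', hsub⟩ := hrec' i hiT
      obtain ⟨z, hz, hzV⟩ := not_subset.1 hV'
      obtain ⟨x, hx, rfl⟩ := hsub (hi hz)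
      exact ⟨G, hG, x, hV hx, hz, fun heq => hzV (heq.symm ▸ hx)⟩
    · obtain ⟨u, hu, rfl⟩ := hi hy
      obtain ⟨r, hr, hball⟩ := Metric.mem_nhds_iff.1 (Filter.inter_mem
        (hγ'.continuous.continuousAt.preimage_mem_nhds ((hUopen i).mem_nhds hy))
        (isOpen_Ioo.mem_nhds hu))
      rw [Real.ball_eq_Ioo] at hball
      have hsub : Ioo u (u + r) ⊆ (h ∘ γ) ⁻¹' U i ∩ Ioo a b :=
        (Ioo_subset_Ioo_left (by linarith)).trans hball
      have hsub' : Ioo u (u + r) ⊆ Ioo a b := hsub.trans inter_subset_right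
      refine ⟨u, u + r, hJ'.mono (by linarith) hsub', fun j hj => ?_⟩
      rcases Finset.mem_insert.1 hj with rfl | hj
      · refine ⟨id, (h ∘ γ) '' Ioo u (u + r), Or.inl rfl,
          image_subset_iff.2 (hsub.trans inter_subset_left), fun hcon => ?_, by rw [image_id]⟩
        obtain ⟨v, hv, hvu⟩ := hcon hy
        exact hv.1.ne' (hγ'.injective hvu)
      · obtain ⟨g, hg, V, hV, hV', hsubV⟩ := hrec' j hj
        exact ⟨g, V, Or.inr hg, hV, hV', (image_mono hsub').trans hsubV⟩
  intro k
  induction k with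
  | zero =>
    intro T hT γ a b hJ hrec
    obtain rfl : T = Finset.univ := (Finset.card_eq_iff_eq_univ T).1
      (le_antisymm (Finset.card_le_univ T) hT)
    obtain ⟨γ', i, hret, -⟩ := step _ γ a b hJ hrec
    exact ⟨γ', hret (Finset.mem_univ i)⟩
  | succ k ih =>
    intro T hT γ a b hJ hrec
    obtain ⟨γ', i, hret, a', b', hJ', hrec'⟩ := step T γ a b hJ hrec
    by_cases hiT : i ∈ T
    · exact ⟨γ', hret hiT⟩
    · exact ih (insert i T) (by rw [Finset.card_insert_of_notMem hiT]; omega) γ' a' b' hJ' hrec'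

/-- A jumping interval can be shrunk so that it also jumps under a further map, which returns to a
cover member that none of the previous maps returns to. -/
theorem IsJumping.exists_insert [T2Space X] (hemb : ∀ h ∈ F, ∀ γ : ℝ → X, IsOpenEmbedding γ →
      IsOpenEmbedding (h ∘ γ))
    (hexp : ∀ γ : ℝ → X, IsOpenEmbedding γ → ∀ a b, a < b →
      ∃ h ∈ F, ∃ i, (U i).Nonempty ∧ U i ⊆ (h ∘ γ) '' Ioo a b)
    (hUopen : ∀ i, IsOpen (U i)) (hsemi : ∀ f ∈ F, ∀ g ∈ F, f ∘ g ∈ F)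
    (hcomm : ∀ f ∈ F, ∀ g ∈ F, f ∘ g = g ∘ f) (hLF : L ⊆ F) (hJ : IsJumping L γ a b) :
    ∃ G ∈ F, ∃ i, ¬ Disjoint (G '' U i) (U i) ∧ (∀ f ∈ L, Disjoint (f '' U i) (U i)) ∧
      ∃ γ' a' b', IsJumping (insert G L) γ' a' b' := by
  obtain ⟨γ, a, b, hJ, i, hi, G, hG, x, hx, hGx, hne⟩ :=
    hJ.exists_return hemb hexp hUopen hsemi hcomm hLF
  refine ⟨G, hG, i, not_disjoint_iff.2 ⟨G x, ⟨x, hx, rfl⟩, hGx⟩,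
    fun f hf => (hJ.disjoint f hf).mono (image_mono hi) hi, γ, ?_⟩
  obtain ⟨u, hu, rfl⟩ := hi hx
  obtain ⟨O₁, O₂, hO₁, hO₂, h1, h2, hd⟩ := t2_separation hne
  have hγ := hJ.isOpenEmbedding.continuous
  have hGγ := (hemb G hG γ hJ.isOpenEmbedding).continuous
  obtain ⟨r, hr, hball⟩ := Metric.mem_nhds_iff.1 (Filter.inter_mem (Filter.inter_mem
    (hGγ.continuousAt.preimage_mem_nhds (((hUopen i).inter hO₁).mem_nhds ⟨hGx, h1⟩))
    (hγ.continuousAt.preimage_mem_nhds (hO₂.mem_nhds h2))) (isOpen_Ioo.mem_nhds hu))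
  rw [Real.ball_eq_Ioo] at hball
  have hJ' := hJ.mono (by linarith) (hball.trans inter_subset_right)
  refine ⟨_, _, hJ.isOpenEmbedding, hJ'.lt, ?_, ?_⟩
  · rintro f (rfl | hf)
    · rintro _ ⟨_, ⟨v, hv, rfl⟩, rfl⟩
      exact image_subset_range _ _ (hi (hball hv).1.1.1)
    · exact hJ'.image_subset f hf
  · rintro f (rfl | hf)
    · refine hd.mono ?_ ?_
      · rintro _ ⟨_, ⟨v, hv, rfl⟩, rfl⟩
        exact (hball hv).1.1.2
      · rintro _ ⟨v, hv, rfl⟩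
        exact (hball hv).1.2
    · exact hJ'.disjoint f hf

/-- A commutative semigroup of maps that are open embeddings along open intervals cannot expand
every open interval over a member of a fixed finite open cover. -/
theorem false_of_forall_isOpenEmbedding_comp [T2Space X]
    (hemb : ∀ h ∈ F, ∀ γ : ℝ → X, IsOpenEmbedding γ → IsOpenEmbedding (h ∘ γ))
    (hexp : ∀ γ : ℝ → X, IsOpenEmbedding γ → ∀ a b, a < b →
      ∃ h ∈ F, ∃ i, (U i).Nonempty ∧ U i ⊆ (h ∘ γ) '' Ioo a b)
    (hUopen : ∀ i, IsOpen (U i)) (hsemi : ∀ f ∈ F, ∀ g ∈ F, f ∘ g ∈ F)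
    (hcomm : ∀ f ∈ F, ∀ g ∈ F, f ∘ g = g ∘ f) (hγ : IsOpenEmbedding γ) : False := by
  classical
  suffices key : ∀ (k : ℕ) (T : Finset ι), Fintype.card ι ≤ T.card + k → ∀ L ⊆ F,
      (∀ i ∈ T, ∃ f ∈ L, ¬ Disjoint (f '' U i) (U i)) →
      ∀ (γ : ℝ → X) (a b : ℝ), ¬ IsJumping L γ a b from
    key (Fintype.card ι) ∅ (by simp) ∅ (empty_subset _) (by simp) γ 0 1
      ⟨hγ, zero_lt_one, by simp, by simp⟩
  intro k
  induction k with
  | zero =>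
    intro T hT L hLF hret γ a b hJ
    obtain rfl : T = Finset.univ := (Finset.card_eq_iff_eq_univ T).1
      (le_antisymm (Finset.card_le_univ T) hT)
    obtain ⟨G, -, i, -, hi, -⟩ := hJ.exists_insert hemb hexp hUopen hsemi hcomm hLF
    obtain ⟨f, hf, hfi⟩ := hret i (Finset.mem_univ i)
    exact hfi (hi f hf)
  | succ k ih =>
    intro T hT L hLF hret γ a b hJ
    obtain ⟨G, hG, i, hGi, hi, γ', a', b', hJ'⟩ :=
      hJ.exists_insert hemb hexp hUopen hsemi hcomm hLF
    have hiT : i ∉ T := by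
      intro hiT
      obtain ⟨f, hf, hfi⟩ := hret i hiT
      exact hfi (hi f hf)
    refine ih (insert i T) (by rw [Finset.card_insert_of_notMem hiT]; omega) (insert G L)
      (insert_subset hG hLF) (fun j hj => ?_) γ' a' b' hJ'
    rcases Finset.mem_insert.1 hj with rfl | hj
    · exact ⟨G, mem_insert _ _, hGi⟩
    · obtain ⟨f, hf, hfj⟩ := hret j hj
      exact ⟨f, mem_insert_of_mem _ hf, hfj⟩

end Sensitive

/-- Claim E: inductive step producing a jumping arc for one more
map of `F` while decreasing `S` by more than `δ`, in the case where `X` has no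
maximal free open interval of Type I. -/
theorem stmt_17 (X : Type*) [MetricSpace X] [CompactSpace X] [ConnectedSpace X]
    [LocallyConnectedSpace X]
    (hfree : ∃ A : Set X, IsFreeArc A)
    (harc : ¬ SpaceIsArc X) (hcirc : ¬ SpaceIsCircle X)
    (hnoI : ∀ J : Set X, ¬ IsTypeI J)
    (F : Set (X → X))
    (hcont : ∀ f ∈ F, Continuous f)
    (hopen : ∀ f ∈ F, IsOpenMap f)
    (hsemi : ∀ f ∈ F, ∀ g ∈ F, f ∘ g ∈ F)
    (hcomm : ∀ f ∈ F, ∀ g ∈ F, f ∘ g = g ∘ f)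
    (c ε δ : ℝ) (hc : 0 < c)
    (hsens : ∀ U : Set X, IsOpen U → U.Nonempty → ∃ f ∈ F, c < Metric.diam (f '' U))
    (hε : ε = c / 7)
    (hδ0 : 0 < δ) (hδε : δ ≤ ε / 2)
    (hδ : ∀ p q : X, 0 < dist p q → dist p q ≤ δ →
      ∃ B : Set X, IsArcEnds B p q ∧ Metric.diam B < ε)
    (n : ℕ) (U : Fin n → Set X)
    (hUopen : ∀ i, IsOpen (U i))
    (hUarc : ∀ i, ∀ x ∈ U i, ∀ y ∈ U i, x ≠ y → ∃ A : Set X, A ⊆ U i ∧ IsArcEnds A x y)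
    (hUcover : (⋃ i, U i) = Set.univ)
    (hUdiam : ∀ i, Metric.diam (U i) < ε)
    (m : ℕ) (f : Fin m → X → X) (hf : ∀ j, f j ∈ F)
    (A : Set X) (hA : IsFreeArc A)
    (hjump : ∀ j : Fin m, A ∩ (f j '' A) = ∅)
    (J : Set X) (hJ : IsMaxFreeOpenInterval J)
    (hAJ : A ⊆ J) (hfAJ : ∀ j : Fin m, f j '' A ⊆ J) :
    ∃ A' : Set X, ∃ g ∈ F, IsFreeArc A' ∧
      (∀ j : Fin (m + 1), A' ∩ ((Fin.snoc f g : Fin (m + 1) → X → X) j '' A') = ∅) ∧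
      (∃ K : Set X, IsMaxFreeOpenInterval K ∧ A' ⊆ K ∧
        ∀ j : Fin (m + 1), (Fin.snoc f g : Fin (m + 1) → X → X) j '' A' ⊆ K) ∧
      (∑ i : Fin n, setDist (U i)
          (⋃ j : Fin (m + 1), (Fin.snoc f g : Fin (m + 1) → X → X) j '' U i)) <
        (∑ i : Fin n, setDist (U i) (⋃ j : Fin m, f j '' U i)) - δ := by
  exfalso
  have hX : Nontrivial X := by
    by_contra hX
    rw [not_nontrivial_iff_subsingleton] at hX
    obtain ⟨h, -, hh⟩ := hsens univ isOpen_univ univ_nonempty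
    rw [diam_subsingleton (subsingleton_of_subsingleton)] at hh
    exact hc.not_gt hh
  have hemb : ∀ h ∈ F, ∀ γ : ℝ → X, IsOpenEmbedding γ → IsOpenEmbedding (h ∘ γ) := by
    intro h hh γ hγ
    have hcγ : Continuous (h ∘ γ) := (hcont h hh).comp hγ.continuous
    have hoγ : IsOpenMap (h ∘ γ) := (hopen h hh).comp hγ.isOpenMap
    exact .of_continuous_injective_isOpenMap hcγ (injective_of_isOpenMap hcγ hoγ hnoI hcirc) hoγ
  have hexp : ∀ γ : ℝ → X, IsOpenEmbedding γ → ∀ a b, a < b →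
      ∃ h ∈ F, ∃ i, (U i).Nonempty ∧ U i ⊆ (h ∘ γ) '' Ioo a b := by
    intro γ hγ a b hab
    obtain ⟨h, hh, hdiam⟩ := hsens (γ '' Ioo a b) (hγ.isOpenMap _ isOpen_Ioo)
      ((nonempty_Ioo.2 hab).image γ)
    rw [← image_comp] at hdiam
    exact ⟨h, hh, exists_subset_image_Ioo (hemb h hh γ hγ) hab (by linarith)
      (fun i => isPreconnected_of_forall_isArcEnds (hUarc i)) hUcover hUdiam⟩
  obtain ⟨γ, hγ, -⟩ := hJ.1.exists_isOpenEmbedding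
  exact false_of_forall_isOpenEmbedding_comp hemb hexp hUopen hsemi hcomm hγ
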